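/- Let n be an integer with 9 ≤ n ≤ 19. Then there exists ε_n > 0 such that for every p with 1 < p < n/(n−8) + ε_n there is no stable classical solution of Δ²u = u^p, u > 0, on ℝⁿ. -/

import Mathlib

open MeasureTheory Real RealInnerProductSpace

/-- The Laplacian of `f : ℝⁿ → ℝ`, as the trace of the second derivative. -/
noncomputable def lap {n : ℕ} (f : EuclideanSpace ℝ (Fin n) → ℝ)
    (x : EuclideanSpace ℝ (Fin n)) : ℝ :=
  ∑ i : Fin n,
    iteratedFDeriv ℝ 2 f x ![EuclideanSpace.single i 1, EuclideanSpace.single i 1]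

/-- Squared Frobenius norm of the Hessian of `f : ℝⁿ → ℝ`. -/
noncomputable def hessNormSq {n : ℕ} (f : EuclideanSpace ℝ (Fin n) → ℝ)
    (x : EuclideanSpace ℝ (Fin n)) : ℝ :=
  ∑ i : Fin n, ∑ j : Fin n,
    (iteratedFDeriv ℝ 2 f x ![EuclideanSpace.single i 1, EuclideanSpace.single j 1]) ^ 2

/-- The quantity `‖∇⁴(φ^{2γ})‖` defined by
`‖∇⁴(φ^{2γ})‖² = φ^{-2γ}|∇φ^γ|⁴ + |φ^γ Δ²φ^γ| + |∇²φ^γ|²`,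
with the first term interpreted as `0` where `φ = 0`. -/
noncomputable def norm4 {n : ℕ} (γ : ℝ) (φ : EuclideanSpace ℝ (Fin n) → ℝ)
    (x : EuclideanSpace ℝ (Fin n)) : ℝ :=
  Real.sqrt
    ((if φ x = 0 then 0 else φ x ^ (-(2*γ)) * ‖gradient (fun y => φ y ^ γ) x‖ ^ 4)
      + |φ x ^ γ * lap (lap (fun y => φ y ^ γ)) x|
      + hessNormSq (fun y => φ y ^ γ) x)

open scoped Laplacian ContDiff InnerProductSpace

/-- Euclidean space of dimension `n`. -/
abbrev Eucl (n : ℕ) : Type := EuclideanSpace ℝ (Fin n)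

/-- The `i`-th partial derivative. -/
noncomputable def pd {n : ℕ} (i : Fin n) (f : Eucl n → ℝ) (x : Eucl n) : ℝ :=
  fderiv ℝ f x (EuclideanSpace.single i 1)

/-- The inner product of the gradients of two functions. -/
noncomputable def gdot {n : ℕ} (f g : Eucl n → ℝ) (x : Eucl n) : ℝ :=
  ∑ i : Fin n, pd i f x * pd i g x

section Calculus

variable {n : ℕ} {f g : Eucl n → ℝ}

lemma lap_eq_laplacian (f : Eucl n → ℝ) : lap f = Δ f := by
  rw [InnerProductSpace.laplacian_eq_iteratedFDeriv_orthonormalBasis f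
    (EuclideanSpace.basisFun (Fin n) ℝ)]
  ext x
  simp [lap]

lemma contDiff_pd {k : WithTop ℕ∞} (i : Fin n) (hf : ContDiff ℝ (k + 1) f) :
    ContDiff ℝ k (pd i f) := by
  unfold pd
  exact (hf.fderiv_right le_rfl).clm_apply contDiff_const

lemma lap_eq_sum (hf : ContDiff ℝ 2 f) : lap f = fun x => ∑ i, pd i (pd i f) x := by
  ext x
  unfold lap
  refine Finset.sum_congr rfl fun i _ => ?_
  rw [iteratedFDeriv_two_apply]
  have h : Differentiable ℝ (fderiv ℝ f) :=
    (hf.fderiv_right (m := 1) (by norm_num)).differentiable (by norm_num)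
  unfold pd
  rw [fderiv_clm_apply (h x) (differentiableAt_const _)]
  simp

lemma contDiff_lap {k : WithTop ℕ∞} (hf : ContDiff ℝ (k + 2) f) : ContDiff ℝ k (lap f) := by
  have e : k + 2 = k + 1 + 1 := by rw [add_assoc]; norm_num
  rw [lap_eq_sum (hf.of_le (by simp))]
  refine ContDiff.sum fun i _ => ?_
  rw [e] at hf
  exact contDiff_pd i (contDiff_pd i hf)

lemma continuous_lap (hf : ContDiff ℝ 2 f) : Continuous (lap f) :=
  (contDiff_lap (k := 0) (by simpa using hf)).continuous

lemma continuous_pd (i : Fin n) (hf : ContDiff ℝ 1 f) : Continuous (pd i f) :=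
  (contDiff_pd (k := 0) i (by simpa using hf)).continuous

lemma continuous_gdot (hf : ContDiff ℝ 1 f) (hg : ContDiff ℝ 1 g) : Continuous (gdot f g) :=
  continuous_finsetSum _ fun i _ => (continuous_pd i hf).mul (continuous_pd i hg)

lemma tsupport_pd_subset (i : Fin n) : tsupport (pd i f) ⊆ tsupport f :=
  tsupport_fderiv_apply_subset ℝ _

lemma HasCompactSupport.pd (i : Fin n) (hf : HasCompactSupport f) : HasCompactSupport (pd i f) :=
  hf.mono' (subset_tsupport _ |>.trans (tsupport_pd_subset i))

lemma lap_eq_zero_of_notMem_tsupport {x : Eucl n} (hx : x ∉ tsupport f) : lap f x = 0 := by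
  unfold lap
  have : iteratedFDeriv ℝ 2 f x = 0 := by
    by_contra h
    exact hx (support_iteratedFDeriv_subset 2 h)
  simp [this]

lemma HasCompactSupport.lap (hf : HasCompactSupport f) : HasCompactSupport (lap f) :=
  hf.mono' fun x hx => by
    by_contra h
    exact hx (lap_eq_zero_of_notMem_tsupport h)

lemma pd_mul (i : Fin n) {x : Eucl n} (hf : DifferentiableAt ℝ f x)
    (hg : DifferentiableAt ℝ g x) :
    pd i (fun y => f y * g y) x = f x * pd i g x + g x * pd i f x := by
  unfold pd
  rw [fderiv_fun_mul hf hg]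
  simp

lemma pd_add (i : Fin n) {x : Eucl n} (hf : DifferentiableAt ℝ f x)
    (hg : DifferentiableAt ℝ g x) :
    pd i (fun y => f y + g y) x = pd i f x + pd i g x := by
  unfold pd
  rw [fderiv_fun_add hf hg]
  simp

lemma pd_comp (i : Fin n) {x : Eucl n} {h : ℝ → ℝ} {h' : ℝ} (hf : DifferentiableAt ℝ f x)
    (hh : HasDerivAt h h' (f x)) : pd i (fun y => h (f y)) x = h' * pd i f x := by
  unfold pd
  have := hh.comp_hasFDerivAt x hf.hasFDerivAt
  rw [show (fun y => h (f y)) = h ∘ f from rfl, this.fderiv]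
  simp

lemma lap_mul (hf : ContDiff ℝ 2 f) (hg : ContDiff ℝ 2 g) (x : Eucl n) :
    lap (fun y => f y * g y) x = f x * lap g x + 2 * gdot f g x + g x * lap f x := by
  have df := hf.differentiable (by norm_num)
  have dg := hg.differentiable (by norm_num)
  have dpf : ∀ i, Differentiable ℝ (pd i f) := fun i =>
    (contDiff_pd (k := 1) i (by simpa [one_add_one_eq_two] using hf)).differentiable (by norm_num)
  have dpg : ∀ i, Differentiable ℝ (pd i g) := fun i =>
    (contDiff_pd (k := 1) i (by simpa [one_add_one_eq_two] using hg)).differentiable (by norm_num)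
  rw [lap_eq_sum (hf.mul hg), lap_eq_sum hf, lap_eq_sum hg, gdot]
  simp only [Finset.mul_sum, ← Finset.sum_add_distrib]
  refine Finset.sum_congr rfl fun i _ => ?_
  have : pd i (fun y => f y * g y) = fun y => f y * pd i g y + g y * pd i f y := by
    ext y; exact pd_mul i (df y) (dg y)
  have h3 := pd_add i ((df x).fun_mul (dpg i x)) ((dg x).fun_mul (dpf i x))
  rw [this, h3, pd_mul i (df x) (dpg i x),
    pd_mul i (dg x) (dpf i x)]
  ring

lemma lap_comp {h h' h'' : ℝ → ℝ} (hf : ContDiff ℝ 2 f) (hhf : ContDiff ℝ 2 fun y => h (f y))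
    (h1 : ∀ x, HasDerivAt h (h' (f x)) (f x)) (h2 : ∀ x, HasDerivAt h' (h'' (f x)) (f x))
    (x : Eucl n) :
    lap (fun y => h (f y)) x = h' (f x) * lap f x + h'' (f x) * gdot f f x := by
  have df := hf.differentiable (by norm_num)
  have dpf : ∀ i, Differentiable ℝ (pd i f) := fun i =>
    (contDiff_pd (k := 1) i (by simpa [one_add_one_eq_two] using hf)).differentiable (by norm_num)
  rw [lap_eq_sum hhf, lap_eq_sum hf, gdot]
  simp only [Finset.mul_sum, ← Finset.sum_add_distrib]
  refine Finset.sum_congr rfl fun i _ => ?_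
  have : pd i (fun y => h (f y)) = fun y => h' (f y) * pd i f y := by
    ext y; exact pd_comp i (df y) (h1 y)
  have d' : DifferentiableAt ℝ (fun y => h' (f y)) x :=
    ((h2 x).comp_hasFDerivAt x (df x).hasFDerivAt).differentiableAt
  rw [this, pd_mul i d' (dpf i x), pd_comp i (df x) (h2 x)]
  ring

lemma lap_add (hf : ContDiff ℝ 2 f) (hg : ContDiff ℝ 2 g) (x : Eucl n) :
    lap (fun y => f y + g y) x = lap f x + lap g x := by
  simp only [lap_eq_laplacian]
  exact hf.contDiffAt.laplacian_add hg.contDiffAt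

lemma lap_const_mul (c : ℝ) (hf : ContDiff ℝ 2 f) (x : Eucl n) :
    lap (fun y => c * f y) x = c * lap f x := by
  simp only [lap_eq_laplacian]
  exact InnerProductSpace.laplacian_smul c hf.contDiffAt

lemma lap_neg (x : Eucl n) : lap (fun y => - f y) x = - lap f x := by
  simp only [lap_eq_laplacian]
  exact congrFun InnerProductSpace.laplacian_neg x

lemma pd_comp_affine (i : Fin n) (hf : Differentiable ℝ f) (c : ℝ) (b x : Eucl n) :
    pd i (fun y => f (b + c • y)) x = c * pd i f (b + c • x) := by
  unfold pd
  have h1 : HasFDerivAt (fun y : Eucl n => b + c • y) (c • ContinuousLinearMap.id ℝ (Eucl n)) x :=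
    ((hasFDerivAt_id x).const_smul c).const_add b
  have := (hf (b + c • x)).hasFDerivAt.comp x h1
  rw [show (fun y => f (b + c • y)) = f ∘ (fun y => b + c • y) from rfl, this.fderiv]
  simp

lemma lap_comp_affine (hf : ContDiff ℝ 2 f) (c : ℝ) (b x : Eucl n) :
    lap (fun y => f (b + c • y)) x = c ^ 2 * lap f (b + c • x) := by
  have dpf : ∀ i, Differentiable ℝ (pd i f) := fun i =>
    (contDiff_pd (k := 1) i (by simpa [one_add_one_eq_two] using hf)).differentiable (by norm_num)
  have h : ContDiff ℝ 2 (fun y => f (b + c • y)) := hf.comp (by fun_prop)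
  rw [lap_eq_sum h, lap_eq_sum hf, Finset.mul_sum]
  refine Finset.sum_congr rfl fun i _ => ?_
  have : pd i (fun y => f (b + c • y)) = fun y => c * pd i f (b + c • y) := by
    ext y; exact pd_comp_affine i (hf.differentiable (by norm_num)) c b y
  rw [this]
  have h2 := pd_comp_affine i (dpf i) c b x
  have h3 : DifferentiableAt ℝ (fun y => pd i f (b + c • y)) x :=
    ((dpf i).comp (g := pd i f) (f := fun y => b + c • y) (by fun_prop)) x
  have := pd_mul i (differentiableAt_const c) h3
  rw [this, h2]
  simp [pd]
  ring

lemma integral_mul_pd (i : Fin n) (hf : ContDiff ℝ 1 f) (hg : ContDiff ℝ 1 g)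
    (hc : HasCompactSupport g) : ∫ x, f x * pd i g x = - ∫ x, pd i f x * g x := by
  refine integral_mul_fderiv_eq_neg_fderiv_mul_of_integrable ?_ ?_ ?_
    (fun x _ => hf.differentiable (by norm_num) x) (fun x _ => hg.differentiable (by norm_num) x)
  · exact ((continuous_pd i hf).mul hg.continuous).integrable_of_hasCompactSupport hc.mul_left
  · exact (hf.continuous.mul (continuous_pd i hg)).integrable_of_hasCompactSupport
      (hc.pd i).mul_left
  · exact (hf.continuous.mul hg.continuous).integrable_of_hasCompactSupport hc.mul_left

lemma integral_mul_lap (hf : ContDiff ℝ 1 f) (hg : ContDiff ℝ 2 g)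
    (hc : HasCompactSupport g) : ∫ x, f x * lap g x = - ∫ x, gdot f g x := by
  have h1 : ∀ i, ContDiff ℝ 1 (pd i g) := fun i =>
    contDiff_pd (k := 1) i (by simpa [one_add_one_eq_two] using hg)
  rw [lap_eq_sum hg]
  unfold gdot
  simp only [Finset.mul_sum]
  rw [integral_finsetSum, integral_finsetSum, ← Finset.sum_neg_distrib]
  · exact Finset.sum_congr rfl fun i _ => integral_mul_pd i hf (h1 i) (hc.pd i)
  · exact fun i _ => ((continuous_pd i hf).mul (h1 i).continuous).integrable_of_hasCompactSupport
      (hc.pd i).mul_left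
  · exact fun i _ => (hf.continuous.mul (continuous_pd i (h1 i))).integrable_of_hasCompactSupport
      ((hc.pd i).pd i).mul_left

lemma integral_lap_mul (hf : ContDiff ℝ 2 f) (hg : ContDiff ℝ 1 g)
    (hc : HasCompactSupport g) : ∫ x, lap f x * g x = - ∫ x, gdot f g x := by
  have h1 : ∀ i, ContDiff ℝ 1 (pd i f) := fun i =>
    contDiff_pd (k := 1) i (by simpa [one_add_one_eq_two] using hf)
  rw [lap_eq_sum hf]
  unfold gdot
  simp only [Finset.sum_mul]
  rw [integral_finsetSum, integral_finsetSum, ← Finset.sum_neg_distrib]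
  · refine Finset.sum_congr rfl fun i _ => ?_
    rw [integral_mul_pd i (h1 i) hg hc, neg_neg]
  · exact fun i _ => ((h1 i).continuous.mul (continuous_pd i hg)).integrable_of_hasCompactSupport
      (hc.pd i).mul_left
  · exact fun i _ => ((continuous_pd i (h1 i)).mul hg.continuous).integrable_of_hasCompactSupport
      hc.mul_left

/-- Green's second identity. -/
lemma integral_lap_mul_eq (hf : ContDiff ℝ 2 f) (hg : ContDiff ℝ 2 g)
    (hc : HasCompactSupport g) : ∫ x, lap f x * g x = ∫ x, f x * lap g x := by
  rw [integral_lap_mul hf (hg.of_le (by norm_num)) hc,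
    integral_mul_lap (hf.of_le (by norm_num)) hg hc]

lemma norm_fderiv_sq (x : Eucl n) : ‖fderiv ℝ f x‖ ^ 2 = gdot f f x := by
  set v := (InnerProductSpace.toDual ℝ (Eucl n)).symm (fderiv ℝ f x) with hv
  have h1 : ‖fderiv ℝ f x‖ = ‖v‖ := by simp [hv]
  have h2 : ∀ i, pd i f x = v i := fun i => by
    have : pd i f x = inner ℝ v (EuclideanSpace.single i 1) := by
      rw [hv, InnerProductSpace.toDual_symm_apply]; rfl
    rw [this]
    simp [EuclideanSpace.inner_single_right]
  rw [h1, EuclideanSpace.norm_sq_eq, gdot]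
  refine Finset.sum_congr rfl fun i _ => ?_
  rw [h2 i, Real.norm_eq_abs, sq_abs, sq]

lemma gdot_self_nonneg (x : Eucl n) : 0 ≤ gdot f f x := by
  rw [← norm_fderiv_sq]; positivity

end Calculus

section Cutoff

variable {n : ℕ}

lemma contDiff_two_of_infty {f : Eucl n → ℝ} (h : ContDiff ℝ ∞ f) : ContDiff ℝ 2 f := by
  exact_mod_cast contDiff_infty.1 h 2

lemma contDiff_four_of_infty {f : Eucl n → ℝ} (h : ContDiff ℝ ∞ f) : ContDiff ℝ 4 f := by
  exact_mod_cast contDiff_infty.1 h 4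

lemma exists_pd_pow_mul {ζ g : Eucl n → ℝ} (hζ : ContDiff ℝ ∞ ζ) (hg : ContDiff ℝ ∞ g) (k : ℕ)
    (i : Fin n) : ∃ h : Eucl n → ℝ, ContDiff ℝ ∞ h ∧
      pd i (fun x => ζ x ^ (k + 1) * g x) = fun x => ζ x ^ k * h x := by
  have dζ := hζ.differentiable (by simp)
  have dg := hg.differentiable (by simp)
  have cζ : ContDiff ℝ ∞ (pd i ζ) := contDiff_pd i (by simpa using hζ)
  have cg : ContDiff ℝ ∞ (pd i g) := contDiff_pd i (by simpa using hg)
  refine ⟨fun x => ζ x * pd i g x + (k + 1) * pd i ζ x * g x, by fun_prop, ?_⟩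
  ext x
  have h1 := pd_mul i ((dζ.pow (k + 1)) x) (dg x)
  have h2 := pd_comp i (dζ x) (hasDerivAt_pow (k + 1) (ζ x))
  simp only [Pi.pow_apply] at h1
  rw [h1]
  have h3 : pd i (ζ ^ (k + 1)) x = pd i (fun y => ζ y ^ (k + 1)) x := rfl
  rw [h3, h2]
  simp only [Nat.add_sub_cancel]
  push_cast
  ring

lemma exists_lap_pow_mul {ζ g : Eucl n → ℝ} (hζ : ContDiff ℝ ∞ ζ) (hg : ContDiff ℝ ∞ g) (k : ℕ) :
    ∃ h : Eucl n → ℝ, ContDiff ℝ ∞ h ∧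
      lap (fun x => ζ x ^ (k + 2) * g x) = fun x => ζ x ^ k * h x := by
  choose h₁ c₁ e₁ using exists_pd_pow_mul hζ hg (k + 1)
  choose h₂ c₂ e₂ using fun i => exists_pd_pow_mul hζ (c₁ i) k i
  refine ⟨fun x => ∑ i, h₂ i x, ContDiff.sum fun i _ => c₂ i, ?_⟩
  rw [lap_eq_sum (contDiff_two_of_infty ((hζ.pow (k + 2)).mul hg))]
  ext x
  rw [Finset.mul_sum]
  refine Finset.sum_congr rfl fun i _ => ?_
  rw [show (fun x => ζ x ^ (k + 2) * g x) = fun x => ζ x ^ (k + 1 + 1) * g x from rfl, e₁ i, e₂ i]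

lemma exists_bound_pow_mul {ζ h : Eucl n → ℝ} (hζ : HasCompactSupport ζ) (h0 : ∀ x, 0 ≤ ζ x)
    (hh : Continuous h) : ∃ C : ℝ, 0 ≤ C ∧ ∀ k : ℕ, k ≠ 0 → ∀ x, |ζ x ^ k * h x| ≤ C * ζ x ^ k := by
  obtain ⟨C, hC⟩ := hζ.exists_bound_of_continuousOn hh.continuousOn
  refine ⟨max C 0, le_max_right _ _, fun k hk x => ?_⟩
  by_cases hx : x ∈ tsupport ζ
  · rw [abs_mul, abs_of_nonneg (pow_nonneg (h0 x) k), mul_comm]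
    gcongr
    · exact pow_nonneg (h0 x) k
    · exact (hC x hx).trans (le_max_left _ _)
  · simp [image_eq_zero_of_notMem_tsupport hx, hk]

lemma exists_bound_lap_pow {ζ : Eucl n → ℝ} (hζ : ContDiff ℝ ∞ ζ) (hc : HasCompactSupport ζ)
    (h0 : ∀ x, 0 ≤ ζ x) (k : ℕ) (hk : k ≠ 0) :
    ∃ C : ℝ, 0 ≤ C ∧ ∀ x, |lap (fun x => ζ x ^ (k + 2)) x| ≤ C * ζ x ^ k := by
  obtain ⟨h, ch, e⟩ := exists_lap_pow_mul hζ (contDiff_const (c := (1 : ℝ))) k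
  obtain ⟨C, hC0, hC⟩ := exists_bound_pow_mul hc h0 ch.continuous
  refine ⟨C, hC0, fun x => ?_⟩
  simp only [mul_one] at e
  rw [e]
  exact hC k hk x

lemma exists_bound_lap_lap_pow {ζ : Eucl n → ℝ} (hζ : ContDiff ℝ ∞ ζ) (hc : HasCompactSupport ζ)
    (h0 : ∀ x, 0 ≤ ζ x) (k : ℕ) (hk : k ≠ 0) :
    ∃ C : ℝ, 0 ≤ C ∧ ∀ x, |lap (lap (fun x => ζ x ^ (k + 4))) x| ≤ C * ζ x ^ k := by
  obtain ⟨h, ch, e⟩ := exists_lap_pow_mul hζ (contDiff_const (c := (1 : ℝ))) (k + 2)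
  obtain ⟨h', ch', e'⟩ := exists_lap_pow_mul hζ ch k
  obtain ⟨C, hC0, hC⟩ := exists_bound_pow_mul hc h0 ch'.continuous
  refine ⟨C, hC0, fun x => ?_⟩
  simp only [mul_one] at e
  rw [show k + 4 = k + 2 + 2 from rfl, e, e']
  exact hC k hk x

lemma exists_cutoff (n : ℕ) {ρ : ℝ} (hρ : 0 < ρ) : ∃ ζ : Eucl n → ℝ, ContDiff ℝ ∞ ζ ∧
    HasCompactSupport ζ ∧ (∀ x, 0 ≤ ζ x) ∧ (∀ x, ζ x ≤ 1) ∧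
    (∀ x ∈ Metric.closedBall (0 : Eucl n) ρ, ζ x = 1) ∧
    tsupport ζ ⊆ Metric.closedBall 0 (2 * ρ) := by
  let b : ContDiffBump (0 : Eucl n) := ⟨ρ, 2 * ρ, hρ, by linarith⟩
  exact ⟨b, b.contDiff, b.hasCompactSupport, fun _ => b.nonneg, fun _ => b.le_one,
    fun x hx => b.one_of_mem_closedBall hx, b.tsupport_eq.subset⟩

end Cutoff

/-- Positive classical solutions of `Δ²u = u^p` on the whole space. -/
structure IsSol {n : ℕ} (p : ℝ) (u : Eucl n → ℝ) : Prop where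
  contDiff : ContDiff ℝ 4 u
  pos : ∀ x, 0 < u x
  eq : ∀ x, lap (lap u) x = u x ^ p

section Rescale

variable {n : ℕ} {p : ℝ} {u : Eucl n → ℝ}

/-- The rescaling preserving `Δ²u = u^p`. -/
noncomputable def rescale (p : ℝ) (R : ℝ) (x₀ : Eucl n) (u : Eucl n → ℝ) (x : Eucl n) : ℝ :=
  R ^ (4 / (p - 1)) * u (x₀ + R • x)

lemma rescale_contDiff {k : WithTop ℕ∞} {R : ℝ} {x₀ : Eucl n} (h : ContDiff ℝ k u) :
    ContDiff ℝ k (rescale p R x₀ u) :=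
  contDiff_const.mul (h.comp (by fun_prop))

lemma lap_rescale {R : ℝ} {x₀ : Eucl n} (h : ContDiff ℝ 2 u) :
    lap (rescale p R x₀ u) = fun x => R ^ (4 / (p - 1)) * (R ^ 2 * lap u (x₀ + R • x)) := by
  ext x
  have h1 : ContDiff ℝ 2 fun x => u (x₀ + R • x) := h.comp (by fun_prop)
  rw [← lap_comp_affine h R x₀ x, ← lap_const_mul _ h1]
  rfl

lemma IsSol.rescale (hp : 1 < p) (h : IsSol p u) {R : ℝ} (hR : 0 < R) (x₀ : Eucl n) :
    IsSol p (rescale p R x₀ u) := by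
  have h2 : ContDiff ℝ 2 u := h.contDiff.of_le (by norm_num)
  refine ⟨rescale_contDiff h.contDiff, fun x => mul_pos (by positivity) (h.pos _), fun x => ?_⟩
  have hl : ContDiff ℝ 2 (lap u) := contDiff_lap (by norm_num; exact h.contDiff)
  rw [lap_rescale h2]
  have h1 : ContDiff ℝ 2 fun x => lap u (x₀ + R • x) := hl.comp (by fun_prop)
  rw [lap_const_mul _ (contDiff_const.mul h1), lap_const_mul _ h1, lap_comp_affine hl, h.eq]
  unfold _root_.rescale
  rw [mul_rpow (by positivity) (h.pos _).le, ← rpow_mul hR.le, ← mul_assoc, ← mul_assoc]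
  congr 1
  rw [← rpow_natCast R 2, ← rpow_add hR, ← rpow_add hR]
  congr 1
  have : p - 1 ≠ 0 := by linarith
  field_simp
  push_cast
  ring

end Rescale

lemma le_one_add_rpow {t q p : ℝ} (ht : 0 ≤ t) (hq : 0 ≤ q) (hqp : q ≤ p) :
    t ^ q ≤ 1 + t ^ p := by
  have := rpow_nonneg ht p
  rcases le_total t 1 with h | h
  · linarith [rpow_le_one ht h hq]
  · linarith [rpow_le_rpow_of_exponent_le h hqp]

lemma exists_young {p : ℝ} (hp : 1 < p) (C : ℝ) :
    ∃ C' : ℝ, 0 ≤ C' ∧ ∀ t : ℝ, 0 ≤ t → C * t ≤ 1 / 2 * t ^ p + C' := by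
  set M := (2 * |C|) ^ (1 / (p - 1)) with hM
  have hM0 : 0 ≤ M := by positivity
  refine ⟨|C| * M, by positivity, fun t ht => ?_⟩
  have hC := le_abs_self C
  have := rpow_nonneg ht p
  rcases le_total t M with h | h
  · nlinarith [mul_le_mul_of_nonneg_right hC ht, mul_le_mul_of_nonneg_left h (abs_nonneg C)]
  · have h1 : 2 * |C| ≤ t ^ (p - 1) := by
      calc 2 * |C| = M ^ (p - 1) := by
            rw [hM, ← rpow_mul (by positivity), one_div_mul_cancel (by linarith), rpow_one]
        _ ≤ _ := rpow_le_rpow hM0 h (by linarith)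
    rcases ht.eq_or_lt with h0 | h0
    · subst h0; simp; positivity
    · have h2 : t ^ p = t ^ (p - 1) * t := by
        rw [← rpow_add_one h0.ne']; ring_nf
      rw [h2]
      have : 0 ≤ |C| * M := by positivity
      nlinarith [mul_le_mul_of_nonneg_right hC ht]

section Apriori

variable {n : ℕ} {p : ℝ}

lemma IsSol.integral_mul_lap_lap {u ψ : Eucl n → ℝ} (h : IsSol p u) (hψ : ContDiff ℝ 4 ψ)
    (hc : HasCompactSupport ψ) : ∫ x, u x ^ p * ψ x = ∫ x, u x * lap (lap ψ) x := by
  have h2 : ContDiff ℝ 2 u := h.contDiff.of_le (by norm_num)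
  have hl : ContDiff ℝ 2 (lap u) := contDiff_lap (by norm_num; exact h.contDiff)
  have hψl : ContDiff ℝ 2 (lap ψ) := contDiff_lap (by norm_num; exact hψ)
  simp only [← h.eq]
  rw [integral_lap_mul_eq hl (hψ.of_le (by norm_num)) hc, integral_lap_mul_eq h2 hψl hc.lap]

lemma IsSol.continuous_rpow {u : Eucl n → ℝ} (h : IsSol p u) (q : ℝ) :
    Continuous fun x => u x ^ q :=
  h.contDiff.continuous.rpow_const fun x => Or.inl (h.pos x).ne'

/-- A bound for the integral of `u ^ p` over a fixed ball, uniform over all solutions. -/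
lemma exists_bound_integral_rpow (n : ℕ) {p : ℝ} (hp : 1 < p) {ρ : ℝ} (hρ : 0 < ρ) :
    ∃ C : ℝ, ∀ u : Eucl n → ℝ, IsSol p u → ∫ x in Metric.closedBall 0 ρ, u x ^ p ≤ C := by
  obtain ⟨ζ, cζ, hc, h0, h1, hone, hsupp⟩ := exists_cutoff n hρ
  obtain ⟨k, hk⟩ := exists_nat_gt (4 / (p - 1) + 1)
  have hk0 : k ≠ 0 := by
    rintro rfl
    have : 0 < 4 / (p - 1) := div_pos (by norm_num) (by linarith)
    simp at hk; linarith
  have hkp : (k : ℝ) + 4 ≤ k * p := by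
    have h4 : 4 / (p - 1) ≤ k := by linarith
    rw [div_le_iff₀ (by linarith)] at h4
    nlinarith
  obtain ⟨C, hC0, hC⟩ := exists_bound_lap_lap_pow cζ hc h0 k hk0
  obtain ⟨C', hC'0, hC'⟩ := exists_young hp C
  set B := Metric.closedBall (0 : Eucl n) (2 * ρ)
  refine ⟨2 * ∫ x in B, C', fun u hu => ?_⟩
  have cψ : ContDiff ℝ 4 (fun x => ζ x ^ (k + 4)) := contDiff_four_of_infty (cζ.pow _)
  have hψc : HasCompactSupport (fun x => ζ x ^ (k + 4)) :=
    hc.comp_left (g := fun t : ℝ => t ^ (k + 4)) (by simp)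
  have key := hu.integral_mul_lap_lap cψ hψc
  have int1 : Integrable (fun x => u x ^ p * ζ x ^ (k + 4)) :=
    ((hu.continuous_rpow p).mul cψ.continuous).integrable_of_hasCompactSupport hψc.mul_left
  have int2 : Integrable (fun x => u x * lap (lap fun x => ζ x ^ (k + 4)) x) :=
    (hu.contDiff.continuous.mul (continuous_lap (contDiff_lap (by norm_num; exact cψ)))
      ).integrable_of_hasCompactSupport hψc.lap.lap.mul_left
  have int3 : Integrable (B.indicator fun _ => C') := by
    rw [integrable_indicator_iff Metric.isClosed_closedBall.measurableSet]
    exact integrableOn_const (isCompact_closedBall _ _).measure_lt_top.ne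
  have le1 : ∫ x, u x * lap (lap fun x => ζ x ^ (k + 4)) x ≤
      ∫ x, (1 / 2 * (u x ^ p * ζ x ^ (k + 4)) + B.indicator (fun _ => C') x) := by
    refine integral_mono int2 ((int1.const_mul _).add int3) fun x => ?_
    have hux := hu.pos x
    by_cases hx : x ∈ B
    · simp only [Set.indicator_of_mem hx]
      have e1 : u x * lap (lap fun x => ζ x ^ (k + 4)) x ≤ C * (u x * ζ x ^ k) := by
        nlinarith [mul_le_mul_of_nonneg_left ((le_abs_self _).trans (hC x)) hux.le]
      have hz := pow_nonneg (h0 x) k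
      have e2 := hC' (u x * ζ x ^ k) (by positivity)
      have e3 : (u x * ζ x ^ k) ^ p ≤ u x ^ p * ζ x ^ (k + 4) := by
        rw [mul_rpow hux.le hz]
        gcongr
        rw [← rpow_natCast, ← rpow_natCast, ← rpow_mul (h0 x)]
        rcases (h0 x).eq_or_lt with hz0 | hz0
        · rw [← hz0, zero_rpow (by positivity), zero_rpow (by positivity)]
        · exact rpow_le_rpow_of_exponent_ge hz0 (h1 x) (by push_cast; linarith)
      linarith
    · have hz : ζ x = 0 := image_eq_zero_of_notMem_tsupport fun h => hx (hsupp h)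
      have := hC x
      rw [hz, zero_pow hk0, mul_zero] at this
      rw [abs_nonpos_iff.1 this, hz]
      simp [hx]
  rw [integral_add (int1.const_mul _) int3, integral_const_mul,
    integral_indicator Metric.isClosed_closedBall.measurableSet, ← key] at le1
  have le2 : ∫ x in Metric.closedBall 0 ρ, u x ^ p ≤ ∫ x, u x ^ p * ζ x ^ (k + 4) := by
    rw [← integral_indicator Metric.isClosed_closedBall.measurableSet]
    refine integral_mono ?_ int1 fun x => ?_
    · rw [integrable_indicator_iff Metric.isClosed_closedBall.measurableSet]
      exact (hu.continuous_rpow p).continuousOn.integrableOn_compact (isCompact_closedBall _ _)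
    · by_cases hx : x ∈ Metric.closedBall 0 ρ
      · simp [Set.indicator_of_mem hx, hone x hx]
      · simp only [Set.indicator_of_notMem hx]
        have := (hu.pos x).le
        have := h0 x
        positivity
  linarith

lemma exists_bound_integral_rpow_of_le (n : ℕ) {p : ℝ} (hp : 1 < p) {q : ℝ} (hq : 0 ≤ q)
    (hqp : q ≤ p) {ρ : ℝ} (hρ : 0 < ρ) :
    ∃ C : ℝ, ∀ u : Eucl n → ℝ, IsSol p u → ∫ x in Metric.closedBall 0 ρ, u x ^ q ≤ C := by
  obtain ⟨C, hC⟩ := exists_bound_integral_rpow n hp hρ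
  refine ⟨(∫ x in Metric.closedBall (0 : Eucl n) ρ, (1 : ℝ)) + C, fun u hu => ?_⟩
  have i1 : ∀ q : ℝ, IntegrableOn (fun x => u x ^ q) (Metric.closedBall 0 ρ) := fun q =>
    (hu.continuous_rpow q).continuousOn.integrableOn_compact (isCompact_closedBall _ _)
  have i2 : IntegrableOn (fun _ : Eucl n => (1 : ℝ)) (Metric.closedBall 0 ρ) :=
    integrableOn_const (isCompact_closedBall _ _).measure_lt_top.ne
  calc ∫ x in Metric.closedBall 0 ρ, u x ^ q
      ≤ ∫ x in Metric.closedBall 0 ρ, (1 + u x ^ p) :=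
        integral_mono (i1 q) (i2.add (i1 p)) fun x => le_one_add_rpow (hu.pos x).le hq hqp
    _ = _ := integral_add i2 (i1 p)
    _ ≤ _ := by gcongr; exact hC u hu

end Apriori

section MeanValue

variable {n : ℕ}

lemma exists_radial_weight (hn : 0 < n) : ∃ φ Ψ : Eucl n → ℝ, ContDiff ℝ ∞ φ ∧ ContDiff ℝ ∞ Ψ ∧
    (∀ x, 0 ≤ φ x) ∧ (∀ x, 0 ≤ Ψ x) ∧ (∀ x ∉ Metric.closedBall (0 : Eucl n) 1, φ x = 0) ∧
    (∀ x ∉ Metric.closedBall (0 : Eucl n) 1, Ψ x = 0) ∧ 0 < ∫ x, φ x ∧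
    ∀ i x, pd i Ψ x = - (x i * φ x) := by
  set χ : ℝ → ℝ := fun t => Real.smoothTransition (1 - 2 * t) with hχ
  have cχ : ContDiff ℝ ∞ χ := Real.smoothTransition.contDiff.comp (by fun_prop)
  have anti : Antitone χ := fun s t hst =>
    Real.smoothTransition.monotone (by linarith)
  have c' : ContDiff ℝ ∞ (deriv χ) := (contDiff_infty_iff_deriv.1 cχ).2
  have z : ∀ t, 1 < t → χ t = 0 := fun t ht =>
    Real.smoothTransition.zero_of_nonpos (by linarith)
  have z' : ∀ t, 1 < t → deriv χ t = 0 := fun t ht => by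
    have : χ =ᶠ[nhds t] fun _ => 0 := by
      filter_upwards [lt_mem_nhds ht] with s hs using z s hs
    rw [this.deriv_eq]; simp
  have hd : ∀ t, deriv χ t ≤ 0 := fun t => by
    exact anti.deriv_nonpos
  have hnorm : ∀ x : Eucl n, x ∉ Metric.closedBall (0 : Eucl n) 1 → 1 < ‖x‖ ^ 2 := fun x hx => by
    have : 1 < ‖x‖ := by simpa using hx
    nlinarith
  have cφ : ContDiff ℝ ∞ fun x : Eucl n => -2 * deriv χ (‖x‖ ^ 2) :=
    contDiff_const.mul (c'.comp (contDiff_norm_sq ℝ))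
  have φz : ∀ x ∉ Metric.closedBall (0 : Eucl n) 1, -2 * deriv χ (‖x‖ ^ 2) = 0 := fun x hx => by
    rw [z' _ (hnorm x hx)]; simp
  refine ⟨fun x => -2 * deriv χ (‖x‖ ^ 2), fun x => χ (‖x‖ ^ 2), cφ,
    cχ.comp (contDiff_norm_sq ℝ), fun x => by linarith [hd (‖x‖ ^ 2)],
    fun x => Real.smoothTransition.nonneg _, φz, fun x hx => z _ (hnorm x hx), ?_, ?_⟩
  · obtain ⟨c, hc, hc'⟩ := exists_deriv_eq_slope χ (a := 0) (b := 1) one_pos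
      cχ.continuous.continuousOn (cχ.differentiable (by simp)).differentiableOn
    have h0 : χ 0 = 1 := by simp [hχ]
    have h1 : χ 1 = 0 := Real.smoothTransition.zero_of_nonpos (by norm_num)
    refine cφ.continuous.integral_pos_of_hasCompactSupport_nonneg_nonzero
      (HasCompactSupport.intro (isCompact_closedBall 0 1) φz)
      (fun x => by simpa using by linarith [hd (‖x‖ ^ 2)])
      (x := EuclideanSpace.single ⟨0, hn⟩ (√c)) ?_
    rw [PiLp.norm_single, Real.norm_eq_abs, sq_abs, Real.sq_sqrt hc.1.le, hc', h0, h1]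
    norm_num
  · intro i x
    have h1 : DifferentiableAt ℝ (fun y : Eucl n => ‖y‖ ^ 2) x :=
      (contDiff_norm_sq ℝ (n := 1)).differentiable (by norm_num) x
    rw [pd_comp i h1 ((cχ.differentiable (by simp)) _).hasDerivAt]
    have : pd i (fun y : Eucl n => ‖y‖ ^ 2) x = 2 * x i := by
      unfold pd
      have := (hasStrictFDerivAt_norm_sq x).hasFDerivAt.fderiv
      rw [this]
      simp [EuclideanSpace.inner_single_right]
    rw [this]; ring

lemma fderiv_apply_eq_sum (w : Eucl n → ℝ) (x y : Eucl n) :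
    fderiv ℝ w x y = ∑ i, pd i w x * y i := by
  conv_lhs => rw [← (EuclideanSpace.basisFun (Fin n) ℝ).sum_repr y]
  simp [pd, mul_comm]

/-- A weak mean value inequality for subharmonic functions, with a fixed radial weight. -/
lemma exists_meanValue_weight (hn : 0 < n) : ∃ φ : Eucl n → ℝ, ContDiff ℝ ∞ φ ∧ (∀ x, 0 ≤ φ x) ∧
    (∀ x ∉ Metric.closedBall (0 : Eucl n) 1, φ x = 0) ∧ 0 < ∫ x, φ x ∧
    ∀ w : Eucl n → ℝ, ContDiff ℝ 2 w → (∀ x, 0 ≤ lap w x) →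
      w 0 * ∫ x, φ x ≤ ∫ x, w x * φ x := by
  obtain ⟨φ, Ψ, cφ, cΨ, hφ, hΨ, zφ, zΨ, hpos, hpd⟩ := exists_radial_weight hn
  refine ⟨φ, cφ, hφ, zφ, hpos, fun w cw hw => ?_⟩
  set B := Metric.closedBall (0 : Eucl n) 1
  have kφ : HasCompactSupport φ := HasCompactSupport.intro (isCompact_closedBall 0 1) zφ
  have kΨ : HasCompactSupport Ψ := HasCompactSupport.intro (isCompact_closedBall 0 1) zΨ
  have c1 : Continuous (fderiv ℝ w) := cw.continuous_fderiv (by norm_num)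
  have dw : Differentiable ℝ w := cw.differentiable (by norm_num)
  have hder : ∀ t : ℝ, HasDerivAt (fun t : ℝ => ∫ y, w (t • y) * φ y)
      (∫ y, fderiv ℝ w (t • y) y * φ y) t := by
    intro t
    obtain ⟨M, hM⟩ := ((isCompact_Icc (a := t - 1) (b := t + 1)).prod
      (isCompact_closedBall (0 : Eucl n) 1)).exists_bound_of_continuousOn
      (f := fun q : ℝ × Eucl n => fderiv ℝ w (q.1 • q.2) q.2 * φ q.2)
      (Continuous.continuousOn (by
        have := cφ.continuous
        have h : Continuous fun q : ℝ × Eucl n => fderiv ℝ w (q.1 • q.2) :=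
          c1.comp (by fun_prop)
        exact (h.clm_apply continuous_snd).mul (this.comp continuous_snd)))
    refine (hasDerivAt_integral_of_dominated_loc_of_deriv_le
      (F' := fun t y => fderiv ℝ w (t • y) y * φ y) (bound := B.indicator fun _ => M)
      (Icc_mem_nhds (a := t - 1) (b := t + 1) (by linarith) (by linarith)) ?_ ?_ ?_ ?_ ?_ ?_).2
    · refine Filter.Eventually.of_forall fun s => Continuous.aestronglyMeasurable ?_
      exact (cw.continuous.comp (by fun_prop)).mul cφ.continuous
    · exact ((cw.continuous.comp (by fun_prop)).mul cφ.continuous).integrable_of_hasCompactSupport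
        kφ.mul_left
    · refine Continuous.aestronglyMeasurable ?_
      exact ((c1.comp (by fun_prop)).clm_apply continuous_id).mul cφ.continuous
    · refine Filter.Eventually.of_forall fun y s hs => ?_
      by_cases hy : y ∈ B
      · rw [Set.indicator_of_mem hy]
        exact hM (s, y) ⟨hs, hy⟩
      · simp [zφ y hy, Set.indicator_of_notMem hy]
    · rw [integrable_indicator_iff Metric.isClosed_closedBall.measurableSet]
      exact integrableOn_const (isCompact_closedBall _ _).measure_lt_top.ne
    · refine Filter.Eventually.of_forall fun y s _ => ?_
      have h1 : HasDerivAt (fun s : ℝ => s • y) y s := by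
        simpa using (hasDerivAt_id s).smul_const y
      exact ((dw (s • y)).hasFDerivAt.comp_hasDerivAt s h1).mul_const _
  have hnn : ∀ t : ℝ, 0 < t → 0 ≤ ∫ y, fderiv ℝ w (t • y) y * φ y := by
    intro t ht
    have cwt : ContDiff ℝ 2 fun y => w (0 + t • y) := cw.comp (by fun_prop)
    have h1 : ∀ y, t * (fderiv ℝ w (t • y) y * φ y) = - gdot (fun y => w (0 + t • y)) Ψ y := by
      intro y
      rw [fderiv_apply_eq_sum, gdot, Finset.sum_mul, Finset.mul_sum, ← Finset.sum_neg_distrib]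
      refine Finset.sum_congr rfl fun i _ => ?_
      rw [pd_comp_affine i dw, hpd, zero_add]
      ring
    have h2 := integral_lap_mul cwt (contDiff_two_of_infty cΨ |>.of_le (by norm_num)) kΨ
    have h3 : 0 ≤ t * ∫ y, fderiv ℝ w (t • y) y * φ y := by
      rw [← integral_const_mul]
      simp only [h1]
      rw [integral_neg, ← h2]
      refine integral_nonneg fun y => ?_
      rw [lap_comp_affine cw]
      exact mul_nonneg (mul_nonneg (by positivity) (hw _)) (hΨ _)
    exact nonneg_of_mul_nonneg_right h3 ht
  have mono : MonotoneOn (fun t : ℝ => ∫ y, w (t • y) * φ y) (Set.Icc 0 1) := by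
    refine monotoneOn_of_deriv_nonneg (convex_Icc 0 1)
      (fun t _ => (hder t).continuousAt.continuousWithinAt)
      (fun t _ => (hder t).differentiableAt.differentiableWithinAt) fun t ht => ?_
    rw [interior_Icc] at ht
    rw [(hder t).deriv]
    exact hnn t ht.1
  have := mono (Set.left_mem_Icc.2 zero_le_one) (Set.right_mem_Icc.2 zero_le_one) zero_le_one
  simpa [integral_const_mul] using this

end MeanValue

/-- A number whose products with arbitrarily large numbers stay bounded is nonpositive. -/
lemma nonpos_of_forall_rpow_mul_le {a C γ : ℝ} (hγ : 0 < γ)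
    (h : ∀ R : ℝ, 0 < R → R ^ γ * a ≤ C) : a ≤ 0 := by
  by_contra! ha
  have h1 := h (((|C| + 1) / a) ^ (1 / γ)) (by positivity)
  rw [← rpow_mul (by positivity), one_div_mul_cancel hγ.ne', rpow_one,
    div_mul_cancel₀ _ ha.ne'] at h1
  linarith [le_abs_self C]

section Pointwise

variable {n : ℕ} {p : ℝ}

lemma integral_mul_le_of_bound {f φ : Eucl n → ℝ} {M : ℝ} (hf : Continuous f) (hφ : Continuous φ)
    (hf0 : ∀ x, 0 ≤ f x) (hM : ∀ x, φ x ≤ M) {ρ : ℝ}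
    (hz : ∀ x ∉ Metric.closedBall (0 : Eucl n) ρ, φ x = 0) :
    ∫ x, f x * φ x ≤ M * ∫ x in Metric.closedBall 0 ρ, f x := by
  rw [← integral_const_mul, ← integral_indicator Metric.isClosed_closedBall.measurableSet]
  refine integral_mono ?_ ?_ fun x => ?_
  · exact (hf.mul hφ).integrable_of_hasCompactSupport
      (HasCompactSupport.intro (isCompact_closedBall 0 ρ) hz).mul_left
  · rw [integrable_indicator_iff Metric.isClosed_closedBall.measurableSet]
    exact (hf.const_mul M).continuousOn.integrableOn_compact (isCompact_closedBall _ _)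
  · by_cases hx : x ∈ Metric.closedBall (0 : Eucl n) ρ
    · simp only [Set.indicator_of_mem hx]
      nlinarith [hf0 x, hM x]
    · simp [Set.indicator_of_notMem hx, hz x hx]

/-- Positive solutions of `Δ²u = u^p` are superharmonic. -/
lemma IsSol.lap_nonpos (hn : 0 < n) (hp : 1 < p) {u : Eucl n → ℝ} (hu : IsSol p u)
    (x₀ : Eucl n) : lap u x₀ ≤ 0 := by
  obtain ⟨φ, cφ, hφ, zφ, hpos, hmean⟩ := exists_meanValue_weight hn
  obtain ⟨C, hC⟩ := exists_bound_integral_rpow_of_le n hp zero_le_one hp.le one_pos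
  have kφ : HasCompactSupport φ := HasCompactSupport.intro (isCompact_closedBall 0 1) zφ
  have cφ2 := contDiff_two_of_infty cφ
  obtain ⟨M, hM⟩ := kφ.lap.exists_bound_of_continuous (continuous_lap cφ2)
  have hM0 : 0 ≤ M := (norm_nonneg _).trans (hM 0)
  have zl : ∀ x ∉ Metric.closedBall (0 : Eucl n) 1, lap φ x = 0 := fun x hx => by
    refine lap_eq_zero_of_notMem_tsupport fun h => hx ?_
    refine closure_minimal ?_ Metric.isClosed_closedBall h
    exact fun y hy => by_contra fun h' => hy (zφ y h')
  have key : ∀ w : Eucl n → ℝ, IsSol p w → lap w 0 * ∫ x, φ x ≤ M * C := by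
    intro w hw
    have w2 : ContDiff ℝ 2 w := hw.contDiff.of_le (by norm_num)
    refine (hmean (lap w) (contDiff_lap (by norm_num; exact hw.contDiff)) fun x => ?_).trans ?_
    · rw [hw.eq]; exact rpow_nonneg (hw.pos x).le _
    · rw [integral_lap_mul_eq w2 cφ2 kφ]
      refine (integral_mul_le_of_bound w2.continuous (continuous_lap cφ2)
        (fun x => (hw.pos x).le) (fun x => (le_abs_self _).trans (hM x)) zl).trans ?_
      have := hC w hw
      simp only [rpow_one] at this
      gcongr
  have h4 : 0 < 4 / (p - 1) := div_pos (by norm_num) (by linarith)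
  refine nonpos_of_forall_rpow_mul_le (γ := 4 / (p - 1) + 2) (C := M * C / ∫ x, φ x) (by linarith)
    fun R hR => ?_
  have := key _ (hu.rescale hp hR x₀)
  rw [lap_rescale (hu.contDiff.of_le (by norm_num))] at this
  rw [le_div_iff₀ hpos]
  simp only [smul_zero, add_zero] at this
  rw [rpow_add hR, rpow_two, mul_assoc (R ^ _)]
  exact this

/-- A convex function of linear growth vanishing exactly on the negative half-line. -/
noncomputable def convexRamp (t : ℝ) : ℝ := (1 + max t 0 ^ 3) ^ (1 / 3 : ℝ) - 1

lemma hasDerivAt_max_pow (k : ℕ) (hk : 2 ≤ k) (t : ℝ) :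
    HasDerivAt (fun t : ℝ => max t 0 ^ k) (k * max t 0 ^ (k - 1)) t := by
  rcases lt_trichotomy t 0 with h | h | h
  · have e : (fun t : ℝ => max t 0 ^ k) =ᶠ[nhds t] fun _ => 0 := by
      filter_upwards [gt_mem_nhds h] with s hs
      rw [max_eq_right hs.le, zero_pow (by omega)]
    refine (e.hasDerivAt_iff).2 ?_
    rw [max_eq_right h.le, zero_pow (by omega), mul_zero]
    exact hasDerivAt_const _ _
  · subst h
    rw [max_self, zero_pow (by omega), mul_zero]
    refine HasDerivAt.of_isLittleO ?_
    simp only [max_self, sub_zero, smul_eq_mul, mul_zero]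
    rw [zero_pow (by omega)]
    simp only [sub_zero]
    have h1 : (fun t : ℝ => max t 0 ^ k) =O[nhds 0] fun t => t ^ k := by
      refine Asymptotics.IsBigO.of_bound 1 (Filter.Eventually.of_forall fun t => ?_)
      rw [one_mul, norm_pow, norm_pow]
      gcongr
      rw [Real.norm_eq_abs, Real.norm_eq_abs, abs_of_nonneg (le_max_right _ _)]
      exact max_le (le_abs_self _) (abs_nonneg _)
    have h2 : (fun t : ℝ => t ^ k) =o[nhds 0] fun t : ℝ => t ^ 1 :=
      Asymptotics.isLittleO_pow_pow (by omega)
    simpa using h1.trans_isLittleO h2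
  · have e : (fun t : ℝ => max t 0 ^ k) =ᶠ[nhds t] fun s => s ^ k := by
      filter_upwards [lt_mem_nhds h] with s hs
      rw [max_eq_left hs.le]
    refine (e.hasDerivAt_iff).2 ?_
    rw [max_eq_left h.le]
    exact hasDerivAt_pow k t

lemma one_le_ramp (t : ℝ) : 1 ≤ 1 + max t 0 ^ 3 := by
  have : 0 ≤ max t 0 ^ 3 := pow_nonneg (le_max_right _ _) 3
  linarith

lemma hasDerivAt_convexRamp (t : ℝ) : HasDerivAt convexRamp
    (max t 0 ^ 2 * (1 + max t 0 ^ 3) ^ (-2 / 3 : ℝ)) t := by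
  have h := ((hasDerivAt_max_pow 3 (by norm_num) t).const_add 1).rpow_const (p := (1 / 3 : ℝ))
    (Or.inl (by linarith [one_le_ramp t]))
  refine (h.sub_const 1).congr_deriv ?_
  rw [show (1 / 3 : ℝ) - 1 = -2 / 3 by norm_num]
  push_cast
  ring

lemma hasDerivAt_convexRamp_deriv (t : ℝ) :
    HasDerivAt (fun t : ℝ => max t 0 ^ 2 * (1 + max t 0 ^ 3) ^ (-2 / 3 : ℝ))
    (2 * max t 0 * (1 + max t 0 ^ 3) ^ (-5 / 3 : ℝ)) t := by
  have h0 : 0 < 1 + max t 0 ^ 3 := by linarith [one_le_ramp t]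
  have h := ((hasDerivAt_max_pow 3 (by norm_num) t).const_add 1).rpow_const (p := (-2 / 3 : ℝ))
    (Or.inl h0.ne')
  refine ((hasDerivAt_max_pow 2 le_rfl t).mul h).congr_deriv ?_
  have e : (1 + max t 0 ^ 3) ^ (-2 / 3 : ℝ) =
      (1 + max t 0 ^ 3) ^ (-5 / 3 : ℝ) * (1 + max t 0 ^ 3) := by
    rw [← rpow_add_one h0.ne']; norm_num
  rw [e]
  norm_num
  ring

lemma contDiff_convexRamp : ContDiff ℝ 2 convexRamp := by
  have h : ContDiff ℝ 1 (deriv convexRamp) := by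
    rw [show deriv convexRamp = _ from funext fun t => (hasDerivAt_convexRamp t).deriv,
      contDiff_one_iff_deriv]
    refine ⟨fun t => (hasDerivAt_convexRamp_deriv t).differentiableAt, ?_⟩
    rw [show deriv _ = _ from funext fun t => (hasDerivAt_convexRamp_deriv t).deriv]
    refine Continuous.mul (by fun_prop) (Continuous.rpow_const (by fun_prop) fun t => Or.inl ?_)
    linarith [one_le_ramp t]
  have := (contDiff_succ_iff_deriv (n := 1) (f := convexRamp)).2
    ⟨fun t => (hasDerivAt_convexRamp t).differentiableAt, by simp, h⟩
  simpa [one_add_one_eq_two] using this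

lemma convexRamp_le {t s : ℝ} (hts : t ≤ s) (hs : 0 ≤ s) : convexRamp t ≤ s := by
  have h : (1 + max t 0 ^ 3) ^ (1 / 3 : ℝ) ≤ 1 + s := by
    have h2 : 1 + max t 0 ^ 3 ≤ (1 + s) ^ (3 : ℕ) := by
      have : max t 0 ^ 3 ≤ s ^ 3 := by gcongr; exact max_le hts hs
      nlinarith [mul_nonneg hs hs]
    calc _ ≤ ((1 + s) ^ (3 : ℕ)) ^ (1 / 3 : ℝ) := by
          apply rpow_le_rpow (by linarith [one_le_ramp t]) h2 (by norm_num)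
      _ = 1 + s := by
          rw [← rpow_natCast, ← rpow_mul (by positivity)]; norm_num
  unfold convexRamp
  linarith

lemma le_convexRamp (t : ℝ) : t ≤ convexRamp t + 1 := by
  unfold convexRamp
  have : (max t 0 ^ (3 : ℕ)) ^ (1 / 3 : ℝ) ≤ (1 + max t 0 ^ 3) ^ (1 / 3 : ℝ) :=
    rpow_le_rpow (by positivity) (by linarith) (by norm_num)
  rw [← rpow_natCast, ← rpow_mul (by positivity)] at this
  norm_num at this
  have h2 := le_max_left t 0
  norm_num
  linarith

/-- Souplet's pointwise comparison between `Δu` and a power of `u`. -/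
lemma IsSol.rpow_le_neg_lap (hn : 0 < n) (hp : 1 < p) {u : Eucl n → ℝ} (hu : IsSol p u)
    (x₀ : Eucl n) : √(2 / (p + 1)) * u x₀ ^ ((p + 1) / 2) ≤ - lap u x₀ := by
  obtain ⟨φ, cφ, hφ, zφ, hpos, hmean⟩ := exists_meanValue_weight hn
  set q := (p + 1) / 2 with hq
  set l := √(2 / (p + 1)) with hl
  have hl0 : 0 < l := Real.sqrt_pos.2 (by positivity)
  have hlq : l ^ 2 * q = 1 := by
    rw [hl, Real.sq_sqrt (by positivity), hq]; field_simp
  obtain ⟨C, hC⟩ := exists_bound_integral_rpow_of_le n hp (q := q) (by rw [hq]; linarith)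
    (by rw [hq]; linarith) one_pos
  have kφ : HasCompactSupport φ := HasCompactSupport.intro (isCompact_closedBall 0 1) zφ
  obtain ⟨M, hM⟩ := kφ.exists_bound_of_continuous cφ.continuous
  have hM0 : 0 ≤ M := (norm_nonneg _).trans (hM 0)
  have key : ∀ w : Eucl n → ℝ, IsSol p w →
      (l * w 0 ^ q + lap w 0) * ∫ x, φ x ≤ M * (l * C) + ∫ x, φ x := by
    intro w hw
    have w2 : ContDiff ℝ 2 w := hw.contDiff.of_le (by norm_num)
    have cl : ContDiff ℝ 2 (lap w) := contDiff_lap (by norm_num; exact hw.contDiff)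
    have cq : ContDiff ℝ 2 fun x => w x ^ q :=
      w2.rpow_const_of_ne fun x => (hw.pos x).ne'
    set z : Eucl n → ℝ := fun x => l * w x ^ q + lap w x with hz
    have cz : ContDiff ℝ 2 z := (contDiff_const.mul cq).add cl
    have hlz : ∀ x, 0 ≤ z x → 0 ≤ lap z x := by
      intro x hzx
      have hw0 := hw.pos x
      rw [hz, lap_add (contDiff_const.mul cq) cl, lap_const_mul _ cq, hw.eq,
        lap_comp (h := fun t => t ^ q) (h' := fun t => q * t ^ (q - 1))
          (h'' := fun t => q * ((q - 1) * t ^ (q - 1 - 1))) w2 cq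
          (fun x => Real.hasDerivAt_rpow_const (Or.inl (hw.pos x).ne'))
          (fun x => (Real.hasDerivAt_rpow_const (Or.inl (hw.pos x).ne')).const_mul q)]
      have h1 : 0 ≤ q * ((q - 1) * w x ^ (q - 1 - 1)) * gdot w w x := by
        have : 0 ≤ q - 1 := by rw [hq]; linarith
        have : 0 ≤ q := by linarith
        have := gdot_self_nonneg (f := w) x
        positivity
      have h2 : w x ^ p = w x ^ (q - 1) * w x ^ q := by
        rw [← rpow_add hw0]; congr 1; rw [hq]; ring
      have h3 : 0 ≤ l * q * w x ^ (q - 1) * z x := by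
        have : 0 ≤ q := by rw [hq]; linarith
        positivity
      have h4 : l * q * w x ^ (q - 1) * z x =
          w x ^ p + l * (q * w x ^ (q - 1) * lap w x) := by
        rw [hz, h2]
        linear_combination (w x ^ (q - 1) * w x ^ q) * hlq
      nlinarith [mul_nonneg hl0.le h1]
    have cg : ContDiff ℝ 2 fun x => convexRamp (z x) := contDiff_convexRamp.comp cz
    have h1 := hmean (fun x => convexRamp (z x)) cg fun x => by
      rw [lap_comp (h := convexRamp)
        (h' := fun t => max t 0 ^ 2 * (1 + max t 0 ^ 3) ^ (-2 / 3 : ℝ))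
        (h'' := fun t => 2 * max t 0 * (1 + max t 0 ^ 3) ^ (-5 / 3 : ℝ)) cz cg
        (fun x => hasDerivAt_convexRamp _)
        (fun x => hasDerivAt_convexRamp_deriv _)]
      have e0 : 0 < 1 + max (z x) 0 ^ 3 := by linarith [one_le_ramp (z x)]
      have e1 : 0 ≤ max (z x) 0 := le_max_right _ _
      have e2 := gdot_self_nonneg (f := z) x
      rcases le_total 0 (z x) with h | h
      · have := hlz x h
        positivity
      · rw [max_eq_right h]; simp
    have h2 : ∫ x, convexRamp (z x) * φ x ≤ ∫ x, l * w x ^ q * φ x := by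
      refine integral_mono ?_ ?_ fun x => ?_
      · exact (cg.continuous.mul cφ.continuous).integrable_of_hasCompactSupport kφ.mul_left
      · exact ((contDiff_const.mul cq).continuous.mul
          cφ.continuous).integrable_of_hasCompactSupport kφ.mul_left
      · refine mul_le_mul_of_nonneg_right (convexRamp_le ?_ ?_) (hφ x)
        · linarith [hw.lap_nonpos hn hp x]
        · have := (hw.pos x).le; positivity
    have h3 := integral_mul_le_of_bound (f := fun x => l * w x ^ q)
      (contDiff_const.mul cq).continuous
      cφ.continuous (fun x => by have := (hw.pos x).le; positivity)
      (fun x => (le_abs_self _).trans (hM x)) zφ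
    rw [integral_const_mul] at h3
    have h4 := hC w hw
    have h5 : M * (l * ∫ x in Metric.closedBall 0 1, w x ^ q) ≤ M * (l * C) := by gcongr
    have h6 := mul_le_mul_of_nonneg_right (le_convexRamp (z 0)) hpos.le
    simp only [add_mul, one_mul] at h6
    simp only [hz] at h6 h1 h2 ⊢
    linarith
  have h4 : 0 < 4 / (p - 1) := div_pos (by norm_num) (by linarith)
  have := nonpos_of_forall_rpow_mul_le (a := l * u x₀ ^ q + lap u x₀) (γ := 4 / (p - 1) + 2)
    (C := (M * (l * C) + ∫ x, φ x) / ∫ x, φ x) (by linarith) fun R hR => by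
      have := key _ (hu.rescale hp hR x₀)
      rw [lap_rescale (hu.contDiff.of_le (by norm_num))] at this
      rw [le_div_iff₀ hpos]
      have e : _root_.rescale p R x₀ u 0 ^ q = R ^ (4 / (p - 1) + 2) * u x₀ ^ q := by
        unfold _root_.rescale
        rw [mul_rpow (by positivity) (hu.pos _).le, ← rpow_mul hR.le, smul_zero, add_zero,
          show 4 / (p - 1) * q = 4 / (p - 1) + 2 by
            have : p - 1 ≠ 0 := by linarith
            rw [hq]; field_simp; ring]
      rw [e] at this
      simp only [smul_zero, add_zero] at this
      refine le_of_eq_of_le ?_ this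
      rw [rpow_add hR, rpow_two]
      ring
  linarith

end Pointwise

section Resolvent

open scoped SchwartzMap

variable {n : ℕ}

lemma hasTemperateGrowth_resolvent {δ : ℝ} (hδ : 0 < δ) :
    (fun ξ : Eucl n => (δ + (2 * π) ^ 2 * ‖ξ‖ ^ 2)⁻¹).HasTemperateGrowth := by
  have h1 : (fun ξ : Eucl n => (2 * π / √δ) • ξ).HasTemperateGrowth := by fun_prop
  have h2 := (Function.HasTemperateGrowth.const (E := Eucl n) (δ⁻¹)).mul
    ((Function.hasTemperateGrowth_one_add_norm_sq_rpow (Eucl n) (-1)).comp h1)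
  refine (congrArg Function.HasTemperateGrowth (funext fun ξ => ?_)).mpr h2
  change _ = δ⁻¹ * (1 + ‖(2 * π / √δ) • ξ‖ ^ 2) ^ (-1 : ℝ)
  rw [norm_smul, rpow_neg_one, ← mul_inv, norm_eq_abs, mul_pow |_|, sq_abs, div_pow,
    Real.sq_sqrt hδ.le]
  field_simp

/-- The equation `δψ - Δψ = f` is solvable in the Schwartz class. -/
lemma exists_resolvent {δ : ℝ} (hδ : 0 < δ) (f : 𝓢(Eucl n, ℝ)) :
    ∃ ψ : 𝓢(Eucl n, ℝ), ∀ x, δ * ψ x - lap ψ x = f x := by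
  set F : 𝓢(Eucl n, ℂ) := f.postcompCLM Complex.ofRealCLM
  set g : Eucl n → ℝ := fun ξ => (δ + (2 * π) ^ 2 * ‖ξ‖ ^ 2)⁻¹
  have hg : g.HasTemperateGrowth := hasTemperateGrowth_resolvent hδ
  have hq : (fun ξ : Eucl n => ‖ξ‖ ^ 2).HasTemperateGrowth := by fun_prop
  set w : 𝓢(Eucl n, ℂ) := SchwartzMap.fourierMultiplierCLM ℂ g F with hw
  have h1 : δ • w - Δ w = F := by
    rw [SchwartzMap.laplacian_eq_fourierMultiplierCLM, hw]
    rw [SchwartzMap.fourierMultiplierCLM_fourierMultiplierCLM_apply (by fun_prop) hg]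
    have e : (fun _ : Eucl n => (1 : ℝ)) = δ • g + ((2 * π) ^ 2) • ((fun ξ => ‖ξ‖ ^ 2) * g) := by
      ext ξ
      simp only [Pi.add_apply, Pi.smul_apply, Pi.mul_apply, smul_eq_mul, g]
      have : δ + (2 * π) ^ 2 * ‖ξ‖ ^ 2 ≠ 0 := by positivity
      field_simp
    have h2 : SchwartzMap.fourierMultiplierCLM ℂ (fun _ : Eucl n => (1 : ℝ)) F = F := by
      rw [SchwartzMap.fourierMultiplierCLM_const]; simp
    conv_rhs => rw [← h2, e]
    rw [SchwartzMap.fourierMultiplierCLM_apply, SchwartzMap.fourierMultiplierCLM_apply,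
      SchwartzMap.fourierMultiplierCLM_apply]
    rw [SchwartzMap.smulLeftCLM_add (by fun_prop) (by fun_prop),
      SchwartzMap.smulLeftCLM_smul hg, SchwartzMap.smulLeftCLM_smul (by fun_prop)]
    simp only [add_apply, smul_apply, FourierTransform.fourierInv_add,
      FourierTransform.fourierInv_smul]
    rw [neg_smul, sub_neg_eq_add]
  refine ⟨w.postcompCLM Complex.reCLM, fun x => ?_⟩
  have h3 : lap (w.postcompCLM Complex.reCLM) x = (Δ w x).re := by
    rw [lap_eq_laplacian, SchwartzMap.laplacian_apply]
    exact ((w.smooth 2).contDiffAt).laplacian_CLM_comp_left (l := Complex.reCLM)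
  rw [h3]
  have := congrArg (fun h : 𝓢(Eucl n, ℂ) => (h x).re) h1
  simpa [F] using this

end Resolvent

section Loewner

/-- A nonnegative log-convex sequence whose even terms are bounded does not increase initially. -/
lemma one_le_zero_of_logConvex {c : ℕ → ℝ} {K : ℝ} (h0 : ∀ m, 0 ≤ c m)
    (hc : ∀ m, c (m + 1) ^ 2 ≤ c m * c (m + 2)) (hK : ∀ k, c (2 * k) ≤ K) : c 1 ≤ c 0 := by
  by_contra! h
  have hpos : 0 < c 0 := by
    refine (h0 0).lt_of_ne fun h1 => ?_
    have := hc 0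
    rw [← h1] at this h
    simp only [zero_add, zero_mul] at this
    nlinarith
  set r := c 1 / c 0 with hr
  have hr1 : 1 < r := (one_lt_div hpos).2 h
  have hstep : ∀ m, 0 < c m ∧ r * c m ≤ c (m + 1) := by
    intro m
    induction m with
    | zero => exact ⟨hpos, by rw [hr, div_mul_cancel₀ _ hpos.ne']⟩
    | succ m ih =>
      have h1 : 0 < c (m + 1) := lt_of_lt_of_le (mul_pos (by linarith) ih.1) ih.2
      refine ⟨h1, ?_⟩
      have h2 := hc m
      have h3 : r * c (m + 1) * c m ≤ c (m + 1 + 1) * c m := by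
        nlinarith [mul_le_mul_of_nonneg_right ih.2 h1.le]
      exact le_of_mul_le_mul_right h3 ih.1
  have hgrow : ∀ m, r ^ m * c 0 ≤ c m := by
    intro m
    induction m with
    | zero => simp
    | succ m ih =>
      calc r ^ (m + 1) * c 0 = r * (r ^ m * c 0) := by ring
        _ ≤ r * c m := by gcongr
        _ ≤ _ := (hstep m).2
  obtain ⟨N, hN⟩ := pow_unbounded_of_one_lt (K / c 0) hr1
  rw [div_lt_iff₀ hpos] at hN
  have h1 := hgrow (2 * N)
  have h2 : r ^ N ≤ r ^ (2 * N) := pow_le_pow_right₀ hr1.le (by omega)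
  nlinarith [hK N]

/-- Operator monotonicity of the square root, for symmetric operators on a subspace. -/
lemma inner_le_inner_of_norm_le {V H : Type*} [AddCommGroup V] [Module ℝ V]
    [NormedAddCommGroup H] [InnerProductSpace ℝ H] (J : V →ₗ[ℝ] H) (A T : V →ₗ[ℝ] V) {δ : ℝ}
    (hδ : 0 < δ) (hA : ∀ f g, ⟪J (A f), J g⟫_ℝ = ⟪J (A g), J f⟫_ℝ)
    (hT : ∀ f g, ⟪J (T f), J g⟫_ℝ = ⟪J (T g), J f⟫_ℝ)
    (hA0 : ∀ f, 0 ≤ ⟪J (A f), J f⟫_ℝ) (hT0 : ∀ f, 0 ≤ ⟪J (T f), J f⟫_ℝ)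
    (hTA : ∀ f, ‖J (T f)‖ ≤ ‖J (A f)‖) (hδA : ∀ f, δ * ‖J f‖ ≤ ‖J (A f)‖)
    (hs : Function.Surjective A) (φ : V) : ⟪J (T φ), J φ⟫_ℝ ≤ ⟪J (A φ), J φ⟫_ℝ := by
  choose S hS using hs
  have cs : ∀ L : V →ₗ[ℝ] V, (∀ f g, ⟪J (L f), J g⟫_ℝ = ⟪J (L g), J f⟫_ℝ) →
      (∀ f, 0 ≤ ⟪J (L f), J f⟫_ℝ) → ∀ f g,
      ⟪J (L f), J g⟫_ℝ ^ 2 ≤ ⟪J (L f), J f⟫_ℝ * ⟪J (L g), J g⟫_ℝ := by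
    intro L hL hL0 f g
    have := LinearMap.BilinForm.apply_mul_apply_le_of_forall_zero_le
      ((innerₗ H).compl₁₂ (J ∘ₗ L) J) (fun x => by simpa using hL0 x) f g
    simp only [LinearMap.compl₁₂_apply, innerₗ_apply_apply, LinearMap.comp_apply] at this
    rw [hL g f] at this
    rw [sq]; exact this
  set ψ : ℕ → V := fun k => (fun f => S (T f))^[k] φ with hψ
  have hψ0 : ψ 0 = φ := rfl
  have hψs : ∀ k, A (ψ (k + 1)) = T (ψ k) := fun k => by
    rw [hψ]; simp only [Function.iterate_succ_apply', hS]
  have hb : ∀ k, ‖J (T (ψ k))‖ ≤ ‖J (T φ)‖ := by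
    intro k
    induction k with
    | zero => rfl
    | succ k ih => exact (hTA _).trans (by rw [hψs]; exact ih)
  set c : ℕ → ℝ := fun m => if Even m then ⟪J (A (ψ (m / 2))), J (ψ (m / 2))⟫_ℝ
    else ⟪J (T (ψ (m / 2))), J (ψ (m / 2))⟫_ℝ with hc
  have ce : ∀ k, c (2 * k) = ⟪J (A (ψ k)), J (ψ k)⟫_ℝ := fun k => by
    simp [hc]
  have co : ∀ k, c (2 * k + 1) = ⟪J (T (ψ k)), J (ψ k)⟫_ℝ := fun k => by
    have : (2 * k + 1) / 2 = k := by omega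
    simp [hc, this]
  have key := one_le_zero_of_logConvex (c := c)
    (K := |c 0| + ‖J (T φ)‖ * (‖J (T φ)‖ / δ)) ?_ ?_ ?_
  · have h0 := ce 0
    have h1 := co 0
    simp only [mul_zero, zero_add] at h0 h1
    rwa [h0, h1] at key
  · intro m
    simp only [hc]
    split_ifs
    · exact hA0 _
    · exact hT0 _
  · intro m
    rcases Nat.even_or_odd' m with ⟨k, rfl | rfl⟩
    · rw [show 2 * k + 2 = 2 * (k + 1) by ring, ce, ce, co, ← hψs]
      have := cs A hA hA0 (ψ (k + 1)) (ψ k)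
      linarith
    · rw [show 2 * k + 1 + 2 = 2 * (k + 1) + 1 by ring, show 2 * k + 1 + 1 = 2 * (k + 1) by ring,
        ce, co, co, hψs]
      exact cs T hT hT0 (ψ k) (ψ (k + 1))
  · intro k
    rcases k with _ | k
    · have : 0 ≤ ‖J (T φ)‖ * (‖J (T φ)‖ / δ) := by positivity
      simpa using (le_abs_self (c 0)).trans (by linarith)
    · rw [ce, hψs]
      have h1 : ‖J (ψ (k + 1))‖ ≤ ‖J (T φ)‖ / δ := by
        rw [le_div_iff₀ hδ]
        have := hδA (ψ (k + 1))
        rw [hψs] at this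
        linarith [hb k]
      have h2 := real_inner_le_norm (J (T (ψ k))) (J (ψ (k + 1)))
      have h3 := mul_le_mul (hb k) h1 (norm_nonneg _) (norm_nonneg _)
      linarith [abs_nonneg (c 0)]

end Loewner

section SchwartzStability

open scoped SchwartzMap LineDeriv

variable {n : ℕ}

lemma schwartz_lap (ψ : 𝓢(Eucl n, ℝ)) : lap ψ = ⇑(Δ ψ : 𝓢(Eucl n, ℝ)) := by
  ext x
  rw [lap_eq_laplacian, SchwartzMap.laplacian_apply]

lemma schwartz_pd (ψ : 𝓢(Eucl n, ℝ)) (i : Fin n) :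
    pd i ψ = ⇑(∂_{(EuclideanSpace.single i 1 : Eucl n)} ψ : 𝓢(Eucl n, ℝ)) := by
  ext x
  rw [SchwartzMap.lineDerivOp_apply_eq_fderiv]; rfl

lemma integral_schwartz_mul_lap_nonpos (ψ : 𝓢(Eucl n, ℝ)) : ∫ x, ψ x * (Δ ψ) x ≤ 0 := by
  rw [SchwartzMap.laplacian_eq_sum (EuclideanSpace.basisFun (Fin n) ℝ)]
  have h : ∀ i : Fin n, ∫ x, ψ x * (∂_{(EuclideanSpace.single i 1 : Eucl n)}
      (∂_{(EuclideanSpace.single i 1 : Eucl n)} ψ)) x ≤ 0 := by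
    intro i
    rw [SchwartzMap.integral_mul_lineDerivOp_right_eq_neg_left, neg_nonpos]
    exact integral_nonneg fun x => mul_self_nonneg _
  simp only [sum_apply, Finset.mul_sum, EuclideanSpace.basisFun_apply]
  rw [integral_finsetSum]
  · exact Finset.sum_nonpos fun i _ => h i
  · intro i _
    exact (ψ.memLp 2).integrable_mul ((∂_{(EuclideanSpace.single i 1 : Eucl n)}
      (∂_{(EuclideanSpace.single i 1 : Eucl n)} ψ)).memLp 2)

lemma schwartz_memLp (ψ : 𝓢(Eucl n, ℝ)) : MemLp (fun x => ψ x) 2 volume := ψ.memLp 2 volume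

lemma integral_sq_le_of_schwartz {b : Eucl n → ℝ} (hb : Continuous b) (hbc : HasCompactSupport b)
    (h : ∀ φ : Eucl n → ℝ, ContDiff ℝ ∞ φ → HasCompactSupport φ →
      ∫ x, (b x * φ x) ^ 2 ≤ ∫ x, lap φ x ^ 2) (ψ : 𝓢(Eucl n, ℝ)) :
    ∫ x, (b x * ψ x) ^ 2 ≤ ∫ x, lap ψ x ^ 2 := by
  obtain ⟨ζ, cζ, kζ, ζ0, ζ1, ζe, -⟩ := exists_cutoff n one_pos
  have ζz : ζ 0 = 1 := ζe 0 (by simp)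
  have cζ2 := contDiff_two_of_infty cζ
  have cψ : ContDiff ℝ ∞ ψ := ψ.smooth _
  have cψ2 := contDiff_two_of_infty cψ
  set t : ℕ → ℝ := fun k => ((k : ℝ) + 1)⁻¹ with ht
  have t0 : ∀ k, 0 < t k := fun k => by positivity
  have t1 : ∀ k, t k ≤ 1 := fun k => inv_le_one_of_one_le₀ (by simp)
  have tlim : Filter.Tendsto t Filter.atTop (nhds 0) :=
    tendsto_inv_atTop_zero.comp (Filter.tendsto_atTop_add_const_right _ _
      tendsto_natCast_atTop_atTop)
  set φ : ℕ → Eucl n → ℝ := fun k x => ζ (0 + t k • x) * ψ x with hφ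
  have cz : ∀ c : ℝ, ContDiff ℝ ∞ fun x : Eucl n => ζ (0 + c • x) := fun c =>
    cζ.comp (by fun_prop)
  have cφ : ∀ k, ContDiff ℝ ∞ (φ k) := fun k => (cz _).mul cψ
  have kφ : ∀ k, HasCompactSupport (φ k) := fun k => by
    refine HasCompactSupport.mul_right ?_
    simp only [zero_add]
    exact kζ.comp_smul (t0 k).ne'
  set L : ℝ → Eucl n → ℝ := fun c x => ζ (0 + c • x) * lap ψ x +
    2 * ∑ i, (c * pd i ζ (0 + c • x)) * pd i ψ x + ψ x * (c ^ 2 * lap ζ (0 + c • x)) with hL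
  have hlap : ∀ k x, lap (φ k) x = L (t k) x := fun k x => by
    rw [hφ, lap_mul (contDiff_two_of_infty (cz _)) cψ2, lap_comp_affine cζ2]
    simp only [gdot, pd_comp_affine _ (cζ2.differentiable (by norm_num)), hL]
  have hcont : ∀ x, Continuous fun c => L c x := fun x => by
    have h1 := cζ.continuous
    have h2 := continuous_lap cζ2
    have h3 : ∀ i, Continuous (pd i ζ) := fun i => continuous_pd i (cζ2.of_le (by norm_num))
    have h4 : ∀ i, Continuous fun c : ℝ => pd i ζ (0 + c • x) := fun i =>
      (h3 i).comp (by fun_prop)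
    have h5 : Continuous fun c : ℝ => lap ζ (0 + c • x) := h2.comp (by fun_prop)
    fun_prop
  have hL0 : ∀ x, L 0 x = lap ψ x := fun x => by simp [hL, ζz]
  have hbound : ∃ C : ℝ, 0 ≤ C ∧ (∀ i x, |pd i ζ x| ≤ C) ∧ ∀ x, |lap ζ x| ≤ C := by
    obtain ⟨C1, h1⟩ := kζ.lap.exists_bound_of_continuous (continuous_lap cζ2)
    have h2 : ∀ i, ∃ C, ∀ x, ‖pd i ζ x‖ ≤ C := fun i =>
      (kζ.pd i).exists_bound_of_continuous (continuous_pd i (cζ2.of_le (by norm_num)))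
    choose C2 h2 using h2
    have h3 : ∀ i, 0 ≤ C2 i := fun i => (norm_nonneg _).trans (h2 i 0)
    have h4 := (norm_nonneg _).trans (h1 0)
    refine ⟨C1 + ∑ i, C2 i, add_nonneg h4 (Finset.sum_nonneg fun i _ => h3 i),
      fun i x => ?_, fun x => ?_⟩
    · have := Finset.single_le_sum (f := C2) (fun i _ => h3 i) (Finset.mem_univ i)
      linarith [h2 i x, Real.norm_eq_abs (pd i ζ x)]
    · have := Finset.sum_nonneg fun i (_ : i ∈ Finset.univ) => h3 i
      linarith [h1 x, Real.norm_eq_abs (lap ζ x)]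
  obtain ⟨C, hC, hC1, hC2⟩ := hbound
  set G : Eucl n → ℝ := fun x => |lap ψ x| + 2 * ∑ i, C * |pd i ψ x| + |ψ x| * C with hG
  have G2 : MemLp G 2 := by
    have m1 : MemLp (fun x => |lap ψ x|) 2 := by
      rw [schwartz_lap]; exact (schwartz_memLp _).abs
    have m2 : ∀ i, MemLp (fun x => C * |pd i ψ x|) 2 := fun i => by
      rw [schwartz_pd]; exact (schwartz_memLp _).abs.const_mul C
    have m3 : MemLp (fun x => ∑ i, C * |pd i ψ x|) 2 :=
      memLp_finsetSum Finset.univ fun i _ => m2 i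
    have m4 : MemLp (fun x => |ψ x| * C) 2 := (schwartz_memLp ψ).abs.mul_const C
    exact (m1.add (m3.const_mul 2)).add m4
  have hLG : ∀ k x, |L (t k) x| ≤ G x := by
    intro k x
    have hζ : |ζ (0 + t k • x)| ≤ 1 := by rw [abs_of_nonneg (ζ0 _)]; exact ζ1 _
    have ht : |t k| ≤ 1 := by rw [abs_of_pos (t0 k)]; exact t1 k
    refine (abs_add_le _ _).trans (add_le_add ((abs_add_le _ _).trans (add_le_add ?_ ?_)) ?_)
    · rw [abs_mul]; exact mul_le_of_le_one_left (abs_nonneg _) hζ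
    · rw [abs_mul, abs_two]
      refine mul_le_mul_of_nonneg_left ((Finset.abs_sum_le_sum_abs _ _).trans
        (Finset.sum_le_sum fun i _ => ?_)) zero_le_two
      rw [abs_mul, abs_mul]
      refine mul_le_mul_of_nonneg_right ?_ (abs_nonneg _)
      exact (mul_le_of_le_one_left (abs_nonneg _) ht).trans (hC1 i _)
    · rw [abs_mul, abs_mul, abs_pow]
      refine mul_le_mul_of_nonneg_left ?_ (abs_nonneg _)
      exact (mul_le_of_le_one_left (abs_nonneg _) (pow_le_one₀ (abs_nonneg _) ht)).trans (hC2 _)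
  have lim2 : Filter.Tendsto (fun k => ∫ x, lap (φ k) x ^ 2) Filter.atTop
      (nhds (∫ x, lap ψ x ^ 2)) := by
    refine tendsto_integral_of_dominated_convergence (fun x => G x ^ 2) (fun k => ?_)
      G2.integrable_sq (fun k => ?_) ?_
    · exact ((continuous_lap (contDiff_two_of_infty (cφ k))).pow 2).aestronglyMeasurable
    · refine Filter.Eventually.of_forall fun x => ?_
      rw [hlap, norm_pow, Real.norm_eq_abs]
      exact pow_le_pow_left₀ (abs_nonneg _) (hLG k x) 2
    · refine Filter.Eventually.of_forall fun x => ?_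
      simp only [hlap]
      rw [← hL0]
      exact (((hcont x).tendsto 0).comp tlim).pow 2
  have lim1 : Filter.Tendsto (fun k => ∫ x, (b x * φ k x) ^ 2) Filter.atTop
      (nhds (∫ x, (b x * ψ x) ^ 2)) := by
    refine tendsto_integral_of_dominated_convergence (fun x => (b x * ψ x) ^ 2) (fun k => ?_)
      ?_ (fun k => ?_) ?_
    · exact ((hb.mul (cφ k).continuous).pow 2).aestronglyMeasurable
    · have h1 : HasCompactSupport fun x => (b x * ψ x) ^ 2 :=
        hbc.mono fun x hx hx' => hx (by simp [hx'])
      exact ((hb.mul cψ.continuous).pow 2).integrable_of_hasCompactSupport h1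
    · refine Filter.Eventually.of_forall fun x => ?_
      rw [Real.norm_eq_abs, abs_of_nonneg (sq_nonneg _), hφ]
      have h1 : (b x * (ζ (0 + t k • x) * ψ x)) ^ 2 = ζ (0 + t k • x) ^ 2 * (b x * ψ x) ^ 2 := by
        ring
      simp only [h1]
      exact mul_le_of_le_one_left (sq_nonneg _) (pow_le_one₀ (ζ0 _) (ζ1 _))
    · refine Filter.Eventually.of_forall fun x => ?_
      have h1 : Continuous fun c : ℝ => (b x * (ζ (0 + c • x) * ψ x)) ^ 2 := by
        have := cζ.continuous
        fun_prop
      have h2 := (h1.tendsto 0).comp tlim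
      simpa [ζz, hφ, Function.comp_def] using h2
  exact le_of_tendsto_of_tendsto' lim1 lim2 fun k => h _ (cφ k) (kφ k)

end SchwartzStability

section WeakStability

open scoped SchwartzMap

variable {n : ℕ}

lemma inner_schwartz_toLp (f g : 𝓢(Eucl n, ℝ)) :
    ⟪f.toLp 2 volume, g.toLp 2 volume⟫_ℝ = ∫ x, f x * g x := by
  rw [L2.inner_def]
  refine integral_congr_ae ?_
  filter_upwards [f.coeFn_toLp 2 volume, g.coeFn_toLp 2 volume] with x hf hg
  rw [hf, hg]
  simp [mul_comm]

lemma integral_mul_sq_le {b : Eucl n → ℝ} (cb : ContDiff ℝ ∞ b) (kb : HasCompactSupport b)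
    (b0 : ∀ x, 0 ≤ b x)
    (h : ∀ φ : Eucl n → ℝ, ContDiff ℝ ∞ φ → HasCompactSupport φ →
      ∫ x, (b x * φ x) ^ 2 ≤ ∫ x, lap φ x ^ 2) {φ : Eucl n → ℝ} (cφ : ContDiff ℝ ∞ φ)
    (kφ : HasCompactSupport φ) : ∫ x, b x * φ x ^ 2 ≤ ∫ x, φ x * - lap φ x := by
  have tb : b.HasTemperateGrowth := kb.hasTemperateGrowth cb
  set J : 𝓢(Eucl n, ℝ) →ₗ[ℝ] Lp ℝ 2 (volume : Measure (Eucl n)) :=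
    (SchwartzMap.toLpCLM ℝ ℝ 2 volume).toLinearMap with hJ
  have J_inner : ∀ f g, ⟪J f, J g⟫_ℝ = ∫ x, f x * g x := inner_schwartz_toLp
  have hsq : ∀ f, ‖J f‖ ^ 2 = ∫ x, f x * f x := fun f => by
    rw [← real_inner_self_eq_norm_sq, J_inner]
  set T : 𝓢(Eucl n, ℝ) →ₗ[ℝ] 𝓢(Eucl n, ℝ) := (SchwartzMap.smulLeftCLM ℝ b).toLinearMap with hT
  have T_apply : ∀ f x, T f x = b x * f x := fun f x => by
    simp [hT, SchwartzMap.smulLeftCLM_apply_apply tb]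
  set D : 𝓢(Eucl n, ℝ) →ₗ[ℝ] 𝓢(Eucl n, ℝ) :=
    (LineDeriv.laplacianCLM ℝ (Eucl n) 𝓢(Eucl n, ℝ)).toLinearMap with hD
  have D_apply : ∀ f, D f = Δ f := fun f => rfl
  have D_nonpos : ∀ f, ⟪J f, J (D f)⟫_ℝ ≤ 0 := fun f => by
    rw [J_inner, D_apply]; exact integral_schwartz_mul_lap_nonpos f
  have D_symm : ∀ f g, ⟪J (D f), J g⟫_ℝ = ⟪J (D g), J f⟫_ℝ := fun f g => by
    rw [real_inner_comm, J_inner, J_inner, D_apply, D_apply,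
      SchwartzMap.integral_mul_laplacian_right_eq_left]
  have T_le : ∀ f, ‖J (T f)‖ ^ 2 ≤ ‖J (D f)‖ ^ 2 := fun f => by
    have := integral_sq_le_of_schwartz cb.continuous kb h f
    rw [schwartz_lap] at this
    rw [hsq, hsq, D_apply]
    simp only [T_apply, ← sq]
    exact this
  set Φ := kφ.toSchwartzMap cφ with hΦ
  have key : ∀ δ : ℝ, 0 < δ →
      ∫ x, b x * φ x ^ 2 ≤ (∫ x, φ x * - lap φ x) + δ * ∫ x, φ x * φ x := by
    intro δ hδ
    set A : 𝓢(Eucl n, ℝ) →ₗ[ℝ] 𝓢(Eucl n, ℝ) := δ • LinearMap.id - D with hA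
    have JA : ∀ f, J (A f) = δ • J f - J (D f) := fun f => by simp [hA]
    have A_sq : ∀ f, ‖J (A f)‖ ^ 2 = δ ^ 2 * ‖J f‖ ^ 2 - 2 * δ * ⟪J f, J (D f)⟫_ℝ
        + ‖J (D f)‖ ^ 2 := fun f => by
      rw [JA, norm_sub_sq_real, norm_smul, inner_smul_left, norm_eq_abs, mul_pow, sq_abs]
      simp only [conj_trivial]
      ring
    have A_inner : ∀ f g, ⟪J (A f), J g⟫_ℝ = δ * ⟪J f, J g⟫_ℝ - ⟪J (D f), J g⟫_ℝ := fun f g => by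
      rw [JA, inner_sub_left, inner_smul_left]; simp
    have main := inner_le_inner_of_norm_le J A T hδ (fun f g => ?_) (fun f g => ?_) (fun f => ?_)
      (fun f => ?_) (fun f => ?_) (fun f => ?_) (fun f => ?_) Φ
    · rw [A_inner, J_inner, J_inner, J_inner] at main
      simp only [T_apply, D_apply] at main
      rw [← schwartz_lap] at main
      have e1 : ∀ x, Φ x = φ x := fun x => rfl
      have e2 : lap Φ = lap φ := rfl
      simp only [e1, e2] at main
      have e3 : ∫ x, φ x * - lap φ x = - ∫ x, lap φ x * φ x := by
        rw [← integral_neg]; congr 1; ext x; ring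
      have e4 : ∫ x, b x * φ x ^ 2 = ∫ x, b x * φ x * φ x := by
        congr 1; ext x; ring
      rw [e3, e4]
      linarith
    · rw [A_inner, A_inner, D_symm f g, real_inner_comm (J f) (J g)]
    · rw [J_inner, J_inner]
      simp only [T_apply]
      congr 1; ext x; ring
    · rw [A_inner, real_inner_self_eq_norm_sq, real_inner_comm]
      have := D_nonpos f
      have : 0 ≤ δ * ‖J f‖ ^ 2 := by positivity
      linarith
    · rw [J_inner]
      simp only [T_apply]
      refine integral_nonneg fun x => ?_
      have := mul_nonneg (b0 x) (mul_self_nonneg (f x))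
      simpa [mul_assoc] using this
    · refine le_of_sq_le_sq ?_ (norm_nonneg _)
      rw [A_sq]
      have h1 := T_le f
      have h2 := D_nonpos f
      have : 0 ≤ δ ^ 2 * ‖J f‖ ^ 2 := by positivity
      nlinarith
    · refine le_of_sq_le_sq ?_ (norm_nonneg _)
      rw [A_sq, mul_pow]
      have h2 := D_nonpos f
      have : 0 ≤ ‖J (D f)‖ ^ 2 := by positivity
      nlinarith
    · obtain ⟨ψ, hψ⟩ := exists_resolvent hδ f
      refine ⟨ψ, SchwartzMap.ext fun x => ?_⟩
      rw [← hψ x, schwartz_lap]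
      simp [hA, D_apply]
  set N := ∫ x, φ x * φ x
  have N0 : 0 ≤ N := integral_nonneg fun x => mul_self_nonneg _
  refine le_of_forall_pos_le_add fun ε hε => (key (ε / (N + 1)) (by positivity)).trans ?_
  have : ε / (N + 1) * N ≤ ε := by
    rw [div_mul_eq_mul_div, div_le_iff₀ (by linarith)]
    nlinarith
  linarith

end WeakStability

section Approximation

variable {n : ℕ}

open scoped Convolution Topology

open Metric in
lemma exists_smooth_approx {φ : Eucl n → ℝ} (hφ : ContDiff ℝ 1 φ) {R : ℝ}
    (hs : ∀ x, x ∉ closedBall (0 : Eucl n) R → φ x = 0) {ε : ℝ} (hε : 0 < ε) :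
    ∃ ψ : Eucl n → ℝ, ContDiff ℝ ∞ ψ ∧ (∀ x, x ∉ closedBall (0 : Eucl n) (R + 1) → ψ x = 0) ∧
      (∀ x, |ψ x - φ x| ≤ ε) ∧ ∀ i x, |pd i ψ x - pd i φ x| ≤ ε := by
  have hc : HasCompactSupport φ :=
    HasCompactSupport.intro (isCompact_closedBall (0 : Eucl n) R) hs
  have huc : ∀ g : Eucl n → ℝ, Continuous g → HasCompactSupport g →
      ∃ δ > 0, ∀ x y, dist x y < δ → dist (g x) (g y) ≤ ε := fun g hg hgc => by
    obtain ⟨δ, h0, h⟩ := Metric.uniformContinuous_iff.1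
      (hgc.uniformContinuous_of_continuous hg) ε hε
    exact ⟨δ, h0, fun x y hxy => (h hxy).le⟩
  obtain ⟨δ₀, hδ₀, h0⟩ := huc φ hφ.continuous hc
  choose δ hδ h1 using fun i => huc (pd i φ) (continuous_pd i hφ) (hc.pd i)
  obtain ⟨r, hr0, hr1, hr2, hr3⟩ : ∃ r > 0, r ≤ 1 ∧ r ≤ δ₀ ∧ ∀ i, r ≤ δ i := by
    obtain ⟨r, hr0, hr⟩ : ∃ r > 0, ∀ i, r ≤ δ i := by
      rcases isEmpty_or_nonempty (Fin n) with h | h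
      · exact ⟨1, one_pos, fun i => h.elim i⟩
      · exact ⟨Finset.univ.inf' Finset.univ_nonempty δ, by simpa using hδ,
          fun i => Finset.inf'_le _ (Finset.mem_univ i)⟩
    exact ⟨min r (min 1 δ₀), by positivity, by simp, by simp,
      fun i => (min_le_left _ _).trans (hr i)⟩
  set β : ContDiffBump (0 : Eucl n) := ⟨r / 2, r, half_pos hr0, half_lt_self hr0⟩ with hβ
  set L := ContinuousLinearMap.lsmul ℝ ℝ (E := ℝ) with hL
  have hβc : Continuous (β.normed volume) := β.contDiff_normed (n := 0) |>.continuous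
  have hβl : LocallyIntegrable (β.normed volume) volume := hβc.locallyIntegrable
  have hconv : ∀ (g : Eucl n → ℝ) (η : ℝ), Continuous g → r ≤ η →
      (∀ x y, dist x y < η → dist (g x) (g y) ≤ ε) →
      ∀ x, |(β.normed volume ⋆[L, volume] g) x - g x| ≤ ε := fun g η hg hη h x => by
    rw [← Real.dist_eq]
    exact β.dist_normed_convolution_le hg.aestronglyMeasurable
      fun y hy => h y x (lt_of_lt_of_le hy hη)
  refine ⟨β.normed volume ⋆[L, volume] φ, ?_, ?_, hconv φ δ₀ hφ.continuous hr2 h0, ?_⟩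
  · exact β.hasCompactSupport_normed.contDiff_convolution_left _ β.contDiff_normed
      hφ.continuous.locallyIntegrable
  · intro x hx
    by_contra hne
    have : x ∈ Function.support (β.normed volume ⋆[L, volume] φ) := hne
    obtain ⟨a, ha, b, hb, rfl⟩ := Set.mem_add.1 (support_convolution_subset L this)
    rw [β.support_normed_eq] at ha
    have hb' : b ∈ closedBall (0 : Eucl n) R := by
      by_contra h; exact hb (hs b h)
    apply hx
    rw [mem_closedBall_zero_iff] at hb' ⊢
    rw [mem_ball_zero_iff] at ha
    have ha' : ‖a‖ < r := ha
    linarith [norm_add_le a b]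
  · intro i x
    have := (hc.hasFDerivAt_convolution_right L hβl hφ x).fderiv
    have e : pd i (β.normed volume ⋆[L, volume] φ) x
        = (β.normed volume ⋆[L, volume] pd i φ) x := by
      rw [pd, this, convolution_precompR_apply L hβl (hc.fderiv ℝ)
        (hφ.continuous_fderiv one_ne_zero)]
      rfl
    rw [e]
    exact hconv _ _ (continuous_pd i hφ) (hr3 i) (h1 i) x

/-- The weak form of stability: the weight `√p u^((p-1)/2)` satisfies a Hardy-type inequality
with the Dirichlet form. -/
def IsWeaklyStable (p : ℝ) (u : Eucl n → ℝ) : Prop :=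
  ∀ φ : Eucl n → ℝ, ContDiff ℝ 1 φ → HasCompactSupport φ →
    √p * ∫ x, u x ^ ((p - 1) / 2) * φ x ^ 2 ≤ ∫ x, gdot φ φ x

open Metric in
lemma integral_mul_sq_le_of_smooth {w : Eucl n → ℝ} (hw : Continuous w)
    (h : ∀ φ : Eucl n → ℝ, ContDiff ℝ ∞ φ → HasCompactSupport φ →
      ∫ x, w x * φ x ^ 2 ≤ ∫ x, gdot φ φ x) {φ : Eucl n → ℝ} (hφ : ContDiff ℝ 1 φ)
    (hc : HasCompactSupport φ) : ∫ x, w x * φ x ^ 2 ≤ ∫ x, gdot φ φ x := by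
  obtain ⟨R, hR⟩ := hc.isCompact.isBounded.subset_closedBall (0 : Eucl n)
  have hs : ∀ x, x ∉ closedBall (0 : Eucl n) R → φ x = 0 := fun x hx =>
    image_eq_zero_of_notMem_tsupport fun hx' => hx (hR hx')
  choose ψ c s d0 d1 using fun k : ℕ =>
    exists_smooth_approx hφ hs (ε := 1 / ((k : ℝ) + 1)) (by positivity)
  have kψ : ∀ k, HasCompactSupport (ψ k) := fun k =>
    HasCompactSupport.intro (isCompact_closedBall (0 : Eucl n) (R + 1)) (s k)
  have small : ∀ k : ℕ, 1 / ((k : ℝ) + 1) ≤ 1 := fun k => by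
    rw [div_le_one (by positivity)]; linarith [Nat.cast_nonneg (α := ℝ) k]
  have lim : ∀ (a : ℕ → ℝ) (b : ℝ), (∀ k, |a k - b| ≤ 1 / ((k : ℝ) + 1)) →
      Filter.Tendsto a Filter.atTop (𝓝 b) := fun a b hab => by
    rw [tendsto_iff_dist_tendsto_zero]
    exact squeeze_zero (fun _ => dist_nonneg) hab tendsto_one_div_add_atTop_nhds_zero_nat
  have lim1 : Filter.Tendsto (fun k => ∫ x, w x * ψ k x ^ 2) Filter.atTop
      (𝓝 (∫ x, w x * φ x ^ 2)) := by
    have cF : Continuous fun x => |w x| * (|φ x| + 1) ^ 2 :=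
      hw.abs.mul ((hφ.continuous.abs.add continuous_const).pow 2)
    refine tendsto_integral_of_dominated_convergence
      ((closedBall (0 : Eucl n) (R + 1)).indicator fun x => |w x| * (|φ x| + 1) ^ 2)
      (fun k => (hw.mul ((c k).continuous.pow 2)).aestronglyMeasurable) ?_ (fun k => ?_) ?_
    · rw [integrable_indicator_iff measurableSet_closedBall]
      exact cF.continuousOn.integrableOn_compact (isCompact_closedBall _ _)
    · refine Filter.Eventually.of_forall fun x => ?_
      by_cases hx : x ∈ closedBall (0 : Eucl n) (R + 1)
      · rw [Set.indicator_of_mem hx, norm_mul, norm_pow, norm_eq_abs, norm_eq_abs]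
        have := (d0 k x).trans (small k)
        have h2 : |ψ k x| ≤ |φ x| + 1 := by
          have := abs_add_le (ψ k x - φ x) (φ x)
          rw [sub_add_cancel] at this; linarith
        gcongr
      · rw [Set.indicator_of_notMem hx, s k x hx]; simp
    · exact Filter.Eventually.of_forall fun x => ((lim _ _ fun k => d0 k x).pow 2).const_mul _
  have lim2 : Filter.Tendsto (fun k => ∫ x, gdot (ψ k) (ψ k) x) Filter.atTop
      (𝓝 (∫ x, gdot φ φ x)) := by
    have cF : Continuous fun x => ∑ i, (|pd i φ x| + 1) ^ 2 :=
      continuous_finsetSum _ fun i _ => ((continuous_pd i hφ).abs.add continuous_const).pow 2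
    have c1 : ∀ k, ContDiff ℝ 1 (ψ k) := fun k => (c k).of_le (by norm_cast)
    refine tendsto_integral_of_dominated_convergence
      ((closedBall (0 : Eucl n) (R + 1)).indicator fun x => ∑ i, (|pd i φ x| + 1) ^ 2)
      (fun k => (continuous_gdot (c1 k) (c1 k)).aestronglyMeasurable) ?_ (fun k => ?_) ?_
    · rw [integrable_indicator_iff measurableSet_closedBall]
      exact cF.continuousOn.integrableOn_compact (isCompact_closedBall _ _)
    · refine Filter.Eventually.of_forall fun x => ?_
      by_cases hx : x ∈ closedBall (0 : Eucl n) (R + 1)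
      · rw [Set.indicator_of_mem hx, norm_eq_abs, abs_of_nonneg (gdot_self_nonneg x)]
        refine Finset.sum_le_sum fun i _ => ?_
        rw [← sq, ← sq_abs]
        have := (d1 k i x).trans (small k)
        have h2 : |pd i (ψ k) x| ≤ |pd i φ x| + 1 := by
          have := abs_add_le (pd i (ψ k) x - pd i φ x) (pd i φ x)
          rw [sub_add_cancel] at this; linarith
        gcongr
      · rw [Set.indicator_of_notMem hx]
        have : ∀ i, pd i (ψ k) x = 0 := fun i => by
          refine image_eq_zero_of_notMem_tsupport fun h => hx ?_
          refine closure_minimal (fun y hy => ?_) isClosed_closedBall (tsupport_pd_subset i h)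
          by_contra h'
          exact hy (s k y h')
        simp [gdot, this]
    · exact Filter.Eventually.of_forall fun x => tendsto_finsetSum _ fun i _ =>
        (lim _ _ fun k => d1 k i x).mul (lim _ _ fun k => d1 k i x)
  exact le_of_tendsto_of_tendsto' lim1 lim2 fun k => h _ (c k) (kψ k)

end Approximation

section WeakStabilityOfStable

variable {n : ℕ}

open scoped Topology Manifold

lemma HasCompactSupport.sq {f : Eucl n → ℝ} (hf : HasCompactSupport f) :
    HasCompactSupport fun x => f x ^ 2 :=
  hf.comp_left (g := fun t : ℝ => t ^ 2) (by simp)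

open Metric in
lemma exists_smooth_le {B : Eucl n → ℝ} (hB : Continuous B) (hB0 : ∀ x, 0 < B x) {ε : ℝ}
    (hε : 0 < ε) (ρ : ℝ) : ∃ b : Eucl n → ℝ, ContDiff ℝ ∞ b ∧ HasCompactSupport b ∧
      (∀ x, 0 ≤ b x) ∧ (∀ x, b x ≤ B x) ∧ ∀ x ∈ closedBall (0 : Eucl n) ρ, B x ≤ b x + ε := by
  obtain ⟨g, hg⟩ := exists_contMDiffMap_forall_mem_convex_of_local_const (n := (⊤ : ℕ∞))
    𝓘(ℝ, Eucl n) (t := fun x => Set.Ioo (max 0 (B x - ε)) (B x)) (fun x => convex_Ioo _ _)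
    (fun x => by
      obtain ⟨c, hc1, hc2⟩ := exists_between (show max 0 (B x - ε) < B x from
        max_lt (hB0 x) (by linarith))
      refine ⟨c, ?_⟩
      have h1 : ∀ᶠ y in 𝓝 x, max 0 (B y - ε) < c :=
        (continuous_const.max (hB.sub continuous_const)).continuousAt.eventually_lt
          continuousAt_const hc1
      have h2 : ∀ᶠ y in 𝓝 x, c < B y :=
        continuousAt_const.eventually_lt hB.continuousAt hc2
      filter_upwards [h1, h2] with y h1 h2 using ⟨h1, h2⟩)
  obtain ⟨ζ, cζ, kζ, ζ0, ζ1, hζ, -⟩ := exists_cutoff n (ρ := max ρ 1) (by positivity)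
  have g0 : ∀ x, 0 < g x := fun x => (le_max_left _ _).trans_lt (hg x).1
  refine ⟨fun x => ζ x * g x, cζ.mul g.contMDiff.contDiff, kζ.mul_right,
    fun x => mul_nonneg (ζ0 x) (g0 x).le, fun x => ?_, fun x hx => ?_⟩
  · nlinarith [ζ1 x, ζ0 x, (hg x).2, g0 x]
  · change B x ≤ ζ x * g x + ε
    rw [hζ x (closedBall_subset_closedBall (le_max_left _ _) hx)]
    have := (le_max_right _ _).trans_lt (hg x).1
    linarith

open Metric in
lemma IsSol.isWeaklyStable {p : ℝ} (hp : 1 < p) {u : Eucl n → ℝ} (hu : IsSol p u)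
    (h : ∀ φ : Eucl n → ℝ, ContDiff ℝ (⊤ : ℕ∞) φ → HasCompactSupport φ →
      p * ∫ x, u x ^ (p - 1) * φ x ^ 2 ≤ ∫ x, (lap φ x) ^ 2) : IsWeaklyStable p u := by
  obtain ⟨B, hB⟩ : ∃ B : Eucl n → ℝ, B = fun x => √p * u x ^ ((p - 1) / 2) := ⟨_, rfl⟩
  have cB : Continuous B := hB ▸ continuous_const.mul
    (hu.contDiff.continuous.rpow_const fun x => Or.inl (hu.pos x).ne')
  have B0 : ∀ x, 0 < B x := fun x => hB ▸
    mul_pos (Real.sqrt_pos.2 (by linarith)) (rpow_pos_of_pos (hu.pos x) _)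
  have Bsq : ∀ x, B x ^ 2 = p * u x ^ (p - 1) := fun x => by
    rw [hB, mul_pow, Real.sq_sqrt (by linarith), ← rpow_natCast, ← rpow_mul (hu.pos x).le]
    congr 2; push_cast; ring
  intro φ cφ kφ
  suffices H : ∫ x, B x * φ x ^ 2 ≤ ∫ x, gdot φ φ x by
    simpa only [hB, mul_assoc, integral_const_mul] using H
  refine integral_mul_sq_le_of_smooth cB (fun φ cφ kφ => ?_) cφ kφ
  have c2 := contDiff_two_of_infty cφ
  have e : ∫ x, φ x * - lap φ x = ∫ x, gdot φ φ x := by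
    have := integral_mul_lap (c2.of_le (by norm_num)) c2 kφ
    simp only [mul_neg, integral_neg, this, neg_neg]
  obtain ⟨ρ, hρ⟩ := kφ.isCompact.isBounded.subset_closedBall (0 : Eucl n)
  have hs : ∀ x, x ∉ closedBall (0 : Eucl n) ρ → φ x = 0 := fun x hx =>
    image_eq_zero_of_notMem_tsupport fun hx' => hx (hρ hx')
  have kφ2 : HasCompactSupport fun x => φ x ^ 2 := kφ.sq
  have int : ∀ {w : Eucl n → ℝ}, Continuous w → Integrable (fun x => w x * φ x ^ 2) volume := by
    intro w hw
    exact (hw.mul (cφ.continuous.pow 2)).integrable_of_hasCompactSupport kφ2.mul_left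
  rw [← e]
  set N := ∫ x, φ x ^ 2
  have N0 : 0 ≤ N := integral_nonneg fun x => sq_nonneg _
  refine le_of_forall_pos_le_add fun ε hε => ?_
  obtain ⟨b, cb, kb, b0, bB, hb⟩ := exists_smooth_le cB B0 (ε := ε / (N + 1)) (by positivity) ρ
  have key := integral_mul_sq_le cb kb b0 (fun φ cφ kφ => ?_) cφ kφ
  · have h1 : ∫ x, B x * φ x ^ 2 ≤ ∫ x, (b x * φ x ^ 2 + ε / (N + 1) * φ x ^ 2) := by
      refine integral_mono (int cB) ((int cb.continuous).add (int continuous_const)) fun x => ?_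
      by_cases hx : x ∈ closedBall (0 : Eucl n) ρ
      · have := mul_le_mul_of_nonneg_right (hb x hx) (sq_nonneg (φ x))
        simpa only [add_mul] using this
      · simp [hs x hx]
    rw [integral_add (int cb.continuous) (int continuous_const), integral_const_mul] at h1
    have : ε / (N + 1) * N ≤ ε := by
      rw [div_mul_eq_mul_div, div_le_iff₀ (by linarith)]
      nlinarith
    linarith
  · refine le_trans ?_ (h φ cφ kφ)
    rw [← integral_const_mul]
    have hw : Continuous fun x => p * u x ^ (p - 1) := continuous_const.mul
      (hu.contDiff.continuous.rpow_const fun x => Or.inl (hu.pos x).ne')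
    have kφ2 : HasCompactSupport fun x => φ x ^ 2 := kφ.sq
    have kbφ : HasCompactSupport fun x => b x * φ x := kφ.mul_left
    refine integral_mono ?_ ?_ fun x => ?_
    · exact ((cb.continuous.mul cφ.continuous).pow 2).integrable_of_hasCompactSupport
        kbφ.sq
    · simp only [← mul_assoc]
      exact (hw.mul (cφ.continuous.pow 2)).integrable_of_hasCompactSupport kφ2.mul_left
    · simp only [mul_pow, ← mul_assoc, ← Bsq]
      have := b0 x
      gcongr
      exact bB x

lemma IsWeaklyStable.rescale {p : ℝ} (hp : 1 < p) {u : Eucl n → ℝ} (hu0 : ∀ x, 0 < u x)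
    (hu : IsWeaklyStable p u) {R : ℝ} (hR : 0 < R) : IsWeaklyStable p (_root_.rescale p R 0 u) := by
  intro φ cφ kφ
  have cψ : ContDiff ℝ 1 fun y => φ ((0 : Eucl n) + R⁻¹ • y) :=
    cφ.comp (contDiff_const.add (contDiff_id.const_smul R⁻¹))
  have hR' : R⁻¹ ≠ 0 := inv_ne_zero hR.ne'
  have kψ : HasCompactSupport fun y => φ ((0 : Eucl n) + R⁻¹ • y) := by
    simp only [zero_add]
    exact kφ.comp_homeomorph (Homeomorph.smulOfNeZero R⁻¹ hR')
  have key := hu _ cψ kψ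
  have e1 : ∀ x, gdot (fun y => φ ((0 : Eucl n) + R⁻¹ • y)) (fun y => φ ((0 : Eucl n) + R⁻¹ • y)) x
      = R⁻¹ ^ 2 * gdot φ φ (R⁻¹ • x) := fun x => by
    simp only [gdot, pd_comp_affine _ (cφ.differentiable one_ne_zero), Finset.mul_sum]
    refine Finset.sum_congr rfl fun i _ => ?_
    rw [zero_add]; ring
  have e2 : ∀ y, _root_.rescale p R 0 u y ^ ((p - 1) / 2) * φ y ^ 2
      = R ^ 2 * (u (R • y) ^ ((p - 1) / 2) * φ y ^ 2) := fun y => by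
    rw [_root_.rescale, mul_rpow (by positivity) (hu0 _).le, ← rpow_mul hR.le, zero_add]
    have : 4 / (p - 1) * ((p - 1) / 2) = (2 : ℕ) := by
      have : p - 1 ≠ 0 := by linarith
      field_simp; norm_num
    rw [this, rpow_natCast]; ring
  have c1 : ∫ x, u x ^ ((p - 1) / 2) * φ ((0 : Eucl n) + R⁻¹ • x) ^ 2
      = |(R⁻¹ ^ Module.finrank ℝ (Eucl n))⁻¹| * ∫ y, u (R • y) ^ ((p - 1) / 2) * φ y ^ 2 := by
    rw [← smul_eq_mul, ← Measure.integral_comp_smul volume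
      (fun y => u (R • y) ^ ((p - 1) / 2) * φ y ^ 2) R⁻¹]
    simp [smul_smul, hR.ne']
  have c2 : ∫ x, gdot φ φ (R⁻¹ • x)
      = |(R⁻¹ ^ Module.finrank ℝ (Eucl n))⁻¹| * ∫ y, gdot φ φ y := by
    rw [← smul_eq_mul, ← Measure.integral_comp_smul volume]
  simp only [e1, e2, integral_const_mul] at key ⊢
  rw [c1, c2] at key
  set d := |(R⁻¹ ^ Module.finrank ℝ (Eucl n))⁻¹| with hd
  have d0 : 0 < d := by rw [hd]; positivity
  have h2 : d * (√p * ∫ y, u (R • y) ^ ((p - 1) / 2) * φ y ^ 2)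
      ≤ d * (R⁻¹ ^ 2 * ∫ y, gdot φ φ y) := by linarith
  have h3 := le_of_mul_le_mul_left h2 d0
  have h4 := mul_le_mul_of_nonneg_left h3 (sq_nonneg R)
  have h5 : ∀ y : ℝ, R ^ 2 * (R⁻¹ ^ 2 * y) = y := fun y => by field_simp
  rw [h5] at h4
  linarith

end WeakStabilityOfStable

section Caccioppoli

variable {n : ℕ} {f η : Eucl n → ℝ}

lemma HasCompactSupport.gdot (hη : HasCompactSupport η) (f : Eucl n → ℝ) :
    HasCompactSupport (gdot η f) := by
  refine HasCompactSupport.intro hη.isCompact fun x hx => Finset.sum_eq_zero fun i _ => ?_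
  rw [image_eq_zero_of_notMem_tsupport fun h => hx (tsupport_pd_subset i h), zero_mul]

lemma integral_gdot_rpow_mul (hf : ContDiff ℝ 2 f) (h0 : ∀ x, 0 < f x) (hη : ContDiff ℝ 2 η)
    (kη : HasCompactSupport η) {α : ℝ} (hα : 1 / 2 < α) :
    ∫ x, gdot (fun y => f y ^ α * η y) (fun y => f y ^ α * η y) x
      = α ^ 2 / (2 * α - 1) * (∫ x, - lap f x * (f x ^ (2 * α - 1) * (η x * η x)))
        + ∫ x, f x ^ (2 * α) * (gdot η η x +
          (α / (2 * α - 1) - 1) / 2 * lap (fun y => η y * η y) x) := by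
  have cp : ∀ q : ℝ, ContDiff ℝ 2 fun x => f x ^ q := fun q =>
    hf.rpow_const_of_ne fun x => (h0 x).ne'
  have df : Differentiable ℝ f := hf.differentiable (by norm_num)
  have dη : Differentiable ℝ η := hη.differentiable (by norm_num)
  have dp : ∀ q : ℝ, Differentiable ℝ fun x => f x ^ q := fun q =>
    (cp q).differentiable (by norm_num)
  have pdp : ∀ (q : ℝ) i x, pd i (fun y => f y ^ q) x = q * f x ^ (q - 1) * pd i f x :=
    fun q i x => pd_comp i (df x) (hasDerivAt_rpow_const (Or.inl (h0 x).ne'))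
  have cη2 : ContDiff ℝ 2 fun y => η y * η y := hη.mul hη
  have kη2 : HasCompactSupport fun y => η y * η y := kη.mul_left
  have c1 : ∀ {g : Eucl n → ℝ}, ContDiff ℝ 2 g → ContDiff ℝ 1 g := fun h =>
    h.of_le (by norm_num)
  set G : Eucl n → ℝ := fun x => f x ^ (2 * α - 2) * gdot f f x * (η x * η x) with hG
  set M : Eucl n → ℝ := fun x => f x ^ (2 * α - 1) * gdot f η x * η x with hM
  set D : Eucl n → ℝ := fun x => f x ^ (2 * α) * gdot η η x with hD
  set L : Eucl n → ℝ := fun x => f x ^ (2 * α) * lap (fun y => η y * η y) x with hL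
  have iG : Integrable G := (((cp _).continuous.mul (continuous_gdot (c1 hf) (c1 hf))).mul
    cη2.continuous).integrable_of_hasCompactSupport kη2.mul_left
  have iM : Integrable M := (((cp _).continuous.mul (continuous_gdot (c1 hf) (c1 hη))).mul
    hη.continuous).integrable_of_hasCompactSupport kη.mul_left
  have iD : Integrable D := ((cp _).continuous.mul
    (continuous_gdot (c1 hη) (c1 hη))).integrable_of_hasCompactSupport (kη.gdot η).mul_left
  have iL : Integrable L := ((cp _).continuous.mul
    (continuous_lap cη2)).integrable_of_hasCompactSupport kη2.lap.mul_left
  have e1 : ∀ x, gdot (fun y => f y ^ α * η y) (fun y => f y ^ α * η y) x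
      = α ^ 2 * G x + 2 * α * M x + D x := fun x => by
    have r1 : f x ^ (2 * α - 2) = f x ^ (α - 1) * f x ^ (α - 1) := by
      rw [← rpow_add (h0 x)]; congr 1; ring
    have r2 : f x ^ (2 * α - 1) = f x ^ α * f x ^ (α - 1) := by
      rw [← rpow_add (h0 x)]; congr 1; ring
    have r3 : f x ^ (2 * α) = f x ^ α * f x ^ α := by
      rw [← rpow_add (h0 x)]; congr 1; ring
    simp only [hG, hM, hD, r1, r2, r3, gdot, pd_mul _ (dp α x) (dη x), pdp, Finset.mul_sum,
      Finset.sum_mul, ← Finset.sum_add_distrib]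
    exact Finset.sum_congr rfl fun i _ => by ring
  have e2 : ∀ x, gdot f (fun y => f y ^ (2 * α - 1) * (η y * η y)) x
      = (2 * α - 1) * G x + 2 * M x := fun x => by
    have r1 : 2 * α - 1 - 1 = 2 * α - 2 := by ring
    simp only [hG, hM, gdot, pd_mul _ (dp (2 * α - 1) x) (cη2.differentiable (by norm_num) x),
      pd_mul _ (dη x) (dη x), pdp, r1, Finset.mul_sum, Finset.sum_mul, ← Finset.sum_add_distrib]
    exact Finset.sum_congr rfl fun i _ => by ring
  have e3 : ∀ x, gdot (fun y => f y ^ (2 * α)) (fun y => η y * η y) x = 4 * α * M x :=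
    fun x => by
    simp only [hM, gdot, pd_mul _ (dη x) (dη x), pdp, Finset.mul_sum, Finset.sum_mul]
    exact Finset.sum_congr rfl fun i _ => by ring
  have i1 : ∫ x, gdot (fun y => f y ^ α * η y) (fun y => f y ^ α * η y) x
      = α ^ 2 * (∫ x, G x) + 2 * α * (∫ x, M x) + ∫ x, D x := by
    have iGM : Integrable fun x => α ^ 2 * G x + 2 * α * M x :=
      (iG.const_mul _).add (iM.const_mul _)
    simp only [e1]
    rw [integral_add iGM iD,
      integral_add (iG.const_mul _) (iM.const_mul _), integral_const_mul, integral_const_mul]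
  have i2 : ∫ x, - lap f x * (f x ^ (2 * α - 1) * (η x * η x))
      = (2 * α - 1) * (∫ x, G x) + 2 * ∫ x, M x := by
    have := integral_lap_mul hf (c1 ((cp (2 * α - 1)).mul cη2)) kη2.mul_left
    simp only [neg_mul, integral_neg, this, neg_neg, e2]
    rw [integral_add (iG.const_mul _) (iM.const_mul _), integral_const_mul, integral_const_mul]
  have i3 : ∫ x, L x = - (4 * α * ∫ x, M x) := by
    rw [hL, integral_mul_lap (c1 (cp (2 * α))) cη2 kη2]
    simp only [e3, integral_const_mul]
  have i4 : ∫ x, f x ^ (2 * α) * (gdot η η x +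
      (α / (2 * α - 1) - 1) / 2 * lap (fun y => η y * η y) x)
      = (∫ x, D x) + (α / (2 * α - 1) - 1) / 2 * ∫ x, L x := by
    rw [← integral_const_mul, ← integral_add iD (iL.const_mul _)]
    congr 1; ext x; simp only [hD, hL]; ring
  rw [i1, i2, i4, i3]
  have h1 : 2 * α - 1 ≠ 0 := by linarith
  have h2 : α / (2 * α - 1) * (2 * α - 1) = α := div_mul_cancel₀ _ h1
  have h3 : α ^ 2 / (2 * α - 1) = α * (α / (2 * α - 1)) := by ring
  rw [h3]
  linear_combination (- α * ∫ x, G x) * h2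

lemma integral_gdot_rpow_mul_le (hη : ContDiff ℝ 2 η) (kη : HasCompactSupport η)
    {w : Eucl n → ℝ} (cw : Continuous w) (kw : HasCompactSupport w) {C : ℝ}
    (hC : 0 ≤ C)
    (h1 : ∀ x, gdot η η x ≤ C * w x) (h2 : ∀ x, |lap (fun y => η y * η y) x| ≤ C * w x)
    {α : ℝ} (hα : 1 / 2 < α) : ∃ C' : ℝ, 0 ≤ C' ∧ ∀ f : Eucl n → ℝ,
    ContDiff ℝ 2 f → (∀ x, 0 < f x) →
    ∫ x, gdot (fun y => f y ^ α * η y) (fun y => f y ^ α * η y) x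
      ≤ α ^ 2 / (2 * α - 1) * (∫ x, - lap f x * (f x ^ (2 * α - 1) * (η x * η x)))
        + C' * ∫ x, f x ^ (2 * α) * w x := by
  set c := (α / (2 * α - 1) - 1) / 2 with hc
  refine ⟨C + |c| * C, by positivity, fun f hf h0 => ?_⟩
  rw [integral_gdot_rpow_mul hf h0 hη kη hα,
    ← integral_const_mul _ fun x => f x ^ (2 * α) * w x]
  have cp : Continuous fun x => f x ^ (2 * α) :=
    hf.continuous.rpow_const fun x => Or.inl (h0 x).ne'
  have kη2 : HasCompactSupport fun y => η y * η y := kη.mul_left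
  refine add_le_add le_rfl (integral_mono ?_ ?_ fun x => ?_)
  · refine (cp.mul ((continuous_gdot (hη.of_le (by norm_num)) (hη.of_le (by norm_num))).add
      (continuous_const.mul (continuous_lap (hη.mul hη))))).integrable_of_hasCompactSupport ?_
    exact ((kη.gdot η).add kη2.lap.mul_left).mul_left
  · exact (continuous_const.mul (cp.mul cw)).integrable_of_hasCompactSupport kw.mul_left.mul_left
  · have h3 := rpow_nonneg (h0 x).le (2 * α)
    have h4 : c * lap (fun y => η y * η y) x ≤ |c| * (C * w x) :=
      (le_abs_self _).trans (by rw [abs_mul]; exact mul_le_mul_of_nonneg_left (h2 x) (abs_nonneg c))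
    have := mul_le_mul_of_nonneg_left (add_le_add (h1 x) h4) h3
    exact this.trans (le_of_eq (by ring))

end Caccioppoli

section Dirichlet

variable {n : ℕ}

lemma young_sol {p s x y l : ℝ} (hs : 1 < s) (hx : 0 < x) (hy : 0 < y) (hl : 0 < l) :
    y * x ^ ((p + 1) * s / 2 - 1) ≤ l * ((1 - 1 / s) * x ^ ((p - 1) / 2 + (p + 1) * s / 2) +
      1 / s * (l ^ (-s) * (x ^ ((p - 1) / 2) * y ^ s))) := by
  have s0 : 0 < s := by linarith
  have hs1 : 0 ≤ 1 - 1 / s := by rw [sub_nonneg, div_le_one s0]; exact hs.le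
  have := Real.geom_mean_le_arith_mean2_weighted hs1 (by positivity : 0 ≤ 1 / s)
    (by positivity : 0 ≤ x ^ ((p - 1) / 2 + (p + 1) * s / 2))
    (by positivity : 0 ≤ l ^ (-s) * (x ^ ((p - 1) / 2) * y ^ s)) (by ring)
  rw [mul_rpow (by positivity) (by positivity), mul_rpow (by positivity) (by positivity),
    ← rpow_mul hx.le, ← rpow_mul hx.le, ← rpow_mul hy.le, ← rpow_mul hl.le] at this
  have e1 : -s * (1 / s) = -1 := by field_simp
  have e2 : s * (1 / s) = 1 := by field_simp
  have e3 : (p + 1) * s / 2 - 1 =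
      ((p - 1) / 2 + (p + 1) * s / 2) * (1 - 1 / s) + (p - 1) / 2 * (1 / s) := by
    field_simp; ring
  rw [e1, e2, rpow_neg_one, rpow_one] at this
  rw [e3, rpow_add hx]
  refine le_trans (le_of_eq ?_) (mul_le_mul_of_nonneg_left this hl.le)
  field_simp

lemma young_sol' {p s x y l : ℝ} (hs : 1 < s) (hx : 0 < x) (hy : 0 < y) (hl : 0 < l) :
    x ^ p * y ^ (s - 1) ≤ l ^ (s - 1) * (1 / s * x ^ ((p - 1) / 2 + (p + 1) * s / 2) +
      (1 - 1 / s) * (l ^ (-s) * (x ^ ((p - 1) / 2) * y ^ s))) := by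
  have s0 : 0 < s := by linarith
  have hs1 : 0 ≤ 1 - 1 / s := by rw [sub_nonneg, div_le_one s0]; exact hs.le
  have := Real.geom_mean_le_arith_mean2_weighted (by positivity : 0 ≤ 1 / s) hs1
    (by positivity : 0 ≤ x ^ ((p - 1) / 2 + (p + 1) * s / 2))
    (by positivity : 0 ≤ l ^ (-s) * (x ^ ((p - 1) / 2) * y ^ s)) (by ring)
  rw [mul_rpow (by positivity) (by positivity), mul_rpow (by positivity) (by positivity),
    ← rpow_mul hx.le, ← rpow_mul hx.le, ← rpow_mul hy.le, ← rpow_mul hl.le] at this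
  have e1 : -s * (1 - 1 / s) = -(s - 1) := by field_simp
  have e2 : s * (1 - 1 / s) = s - 1 := by field_simp
  have e3 : p = ((p - 1) / 2 + (p + 1) * s / 2) * (1 / s) + (p - 1) / 2 * (1 - 1 / s) := by
    field_simp; ring
  rw [e1, e2, rpow_neg hl.le] at this
  have e4 : x ^ p = x ^ (((p - 1) / 2 + (p + 1) * s / 2) * (1 / s))
      * x ^ ((p - 1) / 2 * (1 - 1 / s)) := by rw [← rpow_add hx, ← e3]
  rw [e4]
  refine le_trans (le_of_eq ?_) (mul_le_mul_of_nonneg_left this (by positivity))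
  have : l ^ (s - 1) ≠ 0 := by positivity
  field_simp

/-- Absorption: two coupled linear inequalities with subcritical product of constants. -/
lemma le_of_coupled {a b p s l I J A B E F : ℝ} (ha : 0 < a) (hb : 0 < b) (hl : 0 < l)
    (hlab : a * l = √(a * b))
    (h1 : √p * I ≤ a * A + E) (h2 : √p * (l ^ s * J) ≤ b * B + F)
    (hA : A ≤ l * ((1 - 1 / s) * I + 1 / s * J))
    (hB : B ≤ l ^ (s - 1) * (1 / s * I + (1 - 1 / s) * J)) :
    (√p - √(a * b)) * (I + J) ≤ E + l ^ (-s) * F := by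
  have h3 := mul_le_mul_of_nonneg_left h2 (rpow_nonneg hl.le (-s))
  have e1 : l ^ (-s) * (√p * (l ^ s * J)) = √p * J := by
    rw [show l ^ (-s) * (√p * (l ^ s * J)) = √p * (l ^ (-s) * l ^ s) * J by ring,
      ← rpow_add hl]; simp
  have h4 := mul_le_mul_of_nonneg_left hB (mul_nonneg (rpow_nonneg hl.le (-s)) hb.le)
  have e2 : l ^ (-s) * b * (l ^ (s - 1) * (1 / s * I + (1 - 1 / s) * J))
      = √(a * b) * (1 / s * I + (1 - 1 / s) * J) := by
    have : l ^ (-s) * l ^ (s - 1) = l⁻¹ := by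
      rw [← rpow_add hl, ← rpow_neg_one]; congr 1; ring
    have hbl : l⁻¹ * b = √(a * b) := by
      have : √(a * b) * √(a * b) = a * b := Real.mul_self_sqrt (by positivity)
      rw [inv_mul_eq_div, div_eq_iff hl.ne']
      have : a * (√(a * b) * l) = a * b := by
        linear_combination this + √(a * b) * hlab
      exact (mul_left_cancel₀ ha.ne' this).symm
    rw [← hbl, ← this]; ring
  have h5 := mul_le_mul_of_nonneg_left hA ha.le
  have e3 : a * (l * ((1 - 1 / s) * I + 1 / s * J))
      = √(a * b) * ((1 - 1 / s) * I + 1 / s * J) := by rw [← hlab]; ring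
  rw [e1] at h3
  rw [e2] at h4
  rw [e3] at h5
  linarith

lemma exists_bound_dirichlet (hn : 0 < n) {p s : ℝ} (hp : 1 < p) (hs : 1 < s)
    (hps : ((p + 1) * s / 4) ^ 2 / (2 * ((p + 1) * s / 4) - 1) *
      ((s / 2) ^ 2 / (2 * (s / 2) - 1)) < p)
    {η w : Eucl n → ℝ} (hη : ContDiff ℝ 2 η) (kη : HasCompactSupport η)
    (cw : Continuous w) (kw : HasCompactSupport w) {C : ℝ} (hC : 0 ≤ C) (w0 : ∀ x, 0 ≤ w x)
    (h1 : ∀ x, gdot η η x ≤ C * w x) (h2 : ∀ x, |lap (fun y => η y * η y) x| ≤ C * w x) :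
    ∃ C' : ℝ, 0 ≤ C' ∧ ∀ u : Eucl n → ℝ, IsSol p u → IsWeaklyStable p u →
      ∫ x, gdot (fun y => (- lap u y) ^ (s / 2) * η y) (fun y => (- lap u y) ^ (s / 2) * η y) x
        ≤ C' * ∫ x, (- lap u x) ^ s * w x := by
  have hα : 1 / 2 < (p + 1) * s / 4 := by nlinarith
  have hβ : 1 / 2 < s / 2 := by linarith
  obtain ⟨C₁, hC₁, H₁⟩ := integral_gdot_rpow_mul_le hη kη cw kw hC h1 h2 hα
  obtain ⟨C₂, hC₂, H₂⟩ := integral_gdot_rpow_mul_le hη kη cw kw hC h1 h2 hβ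
  obtain ⟨a, hadef⟩ : ∃ a, a = ((p + 1) * s / 4) ^ 2 / (2 * ((p + 1) * s / 4) - 1) := ⟨_, rfl⟩
  obtain ⟨b, hbdef⟩ : ∃ b, b = (s / 2) ^ 2 / (2 * (s / 2) - 1) := ⟨_, rfl⟩
  have ha : 0 < a := by rw [hadef]; exact div_pos (by positivity) (by linarith)
  have hb : 0 < b := by rw [hbdef]; exact div_pos (by positivity) (by linarith)
  rw [← hadef, ← hbdef] at hps
  rw [← hadef] at H₁
  rw [← hbdef] at H₂
  obtain ⟨l, hldef⟩ : ∃ l, l = √(a * b) / a := ⟨_, rfl⟩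
  have hl : 0 < l := by rw [hldef]; positivity
  have hlab : a * l = √(a * b) := by rw [hldef]; field_simp
  have hgap : 0 < √p - √(a * b) := sub_pos.2 (Real.sqrt_lt_sqrt (by positivity) hps)
  obtain ⟨K, hK⟩ : ∃ K, K = (√(2 / (p + 1)))⁻¹ ^ s := ⟨_, rfl⟩
  have hK0 : 0 ≤ K := by rw [hK]; positivity
  refine ⟨b * (l ^ (s - 1) * ((C₁ * K + l ^ (-s) * C₂) / (√p - √(a * b)))) + C₂,
    by positivity, fun u hu hst => ?_⟩
  obtain ⟨v, hv⟩ : ∃ v : Eucl n → ℝ, v = fun x => - lap u x := ⟨_, rfl⟩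
  have hvx : ∀ x, v x = - lap u x := fun x => by rw [hv]
  have cu : ContDiff ℝ 2 u := hu.contDiff.of_le (by norm_num)
  have cv : ContDiff ℝ 2 v := by
    rw [hv]; exact (contDiff_lap (by norm_num; exact hu.contDiff)).neg
  have u0 := hu.pos
  have hq : 0 < √(2 / (p + 1)) := Real.sqrt_pos.2 (by positivity)
  have huv : ∀ x, √(2 / (p + 1)) * u x ^ ((p + 1) / 2) ≤ v x := fun x => by
    rw [hvx]; exact hu.rpow_le_neg_lap hn hp x
  have v0 : ∀ x, 0 < v x := fun x =>
    lt_of_lt_of_le (mul_pos hq (rpow_pos_of_pos (u0 x) _)) (huv x)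
  have lapv : ∀ x, - lap v x = u x ^ p := fun x => by
    rw [hv, lap_neg, neg_neg]; exact hu.eq x
  have G₁ := H₁ u cu u0
  have G₂ := H₂ v cv v0
  have cup : ∀ q : ℝ, ContDiff ℝ 2 fun x => u x ^ q := fun q =>
    cu.rpow_const_of_ne fun x => (u0 x).ne'
  have cvp : ∀ q : ℝ, ContDiff ℝ 2 fun x => v x ^ q := fun q =>
    cv.rpow_const_of_ne fun x => (v0 x).ne'
  have kη2 : HasCompactSupport fun y => η y * η y := kη.mul_left
  have S₁ := hst _ (((cup ((p + 1) * s / 4)).mul hη).of_le (by norm_num)) kη.mul_left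
  have S₂ := hst _ (((cvp (s / 2)).mul hη).of_le (by norm_num)) kη.mul_left
  obtain ⟨I, hI⟩ : ∃ I, I = ∫ x, u x ^ ((p - 1) / 2 + (p + 1) * s / 2) * (η x * η x) := ⟨_, rfl⟩
  obtain ⟨J, hJ⟩ : ∃ J, J = ∫ x, l ^ (-s) * (u x ^ ((p - 1) / 2) * v x ^ s) * (η x * η x) :=
    ⟨_, rfl⟩
  have eI : ∫ x, u x ^ ((p - 1) / 2) * (u x ^ ((p + 1) * s / 4) * η x) ^ 2 = I := by
    rw [hI]; congr 1; ext x
    rw [rpow_add (u0 x), show (p + 1) * s / 2 = (p + 1) * s / 4 + (p + 1) * s / 4 by ring,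
      rpow_add (u0 x)]
    ring
  have eJ : ∫ x, u x ^ ((p - 1) / 2) * (v x ^ (s / 2) * η x) ^ 2 = l ^ s * J := by
    rw [hJ, ← integral_const_mul]; congr 1; ext x
    have e1 : l ^ s * l ^ (-s) = 1 := by rw [← rpow_add hl]; simp
    have e2 : v x ^ s = v x ^ (s / 2) * v x ^ (s / 2) := by rw [← rpow_add (v0 x)]; ring_nf
    rw [e2]
    linear_combination (-(u x ^ ((p - 1) / 2) * (v x ^ (s / 2) * η x) ^ 2)) * e1
  have iI : Integrable fun x => u x ^ ((p - 1) / 2 + (p + 1) * s / 2) * (η x * η x) :=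
    ((cup _).continuous.mul (hη.mul hη).continuous).integrable_of_hasCompactSupport kη2.mul_left
  have iJ : Integrable fun x => l ^ (-s) * (u x ^ ((p - 1) / 2) * v x ^ s) * (η x * η x) :=
    ((continuous_const.mul ((cup _).continuous.mul (cvp _).continuous)).mul
      (hη.mul hη).continuous).integrable_of_hasCompactSupport kη2.mul_left
  have hA : ∫ x, - lap u x * (u x ^ (2 * ((p + 1) * s / 4) - 1) * (η x * η x))
      ≤ l * ((1 - 1 / s) * I + 1 / s * J) := by
    rw [hI, hJ, ← integral_const_mul, ← integral_const_mul, ← integral_add (iI.const_mul _)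
      (iJ.const_mul _), ← integral_const_mul]
    refine integral_mono ?_ (((iI.const_mul _).add (iJ.const_mul _)).const_mul _) fun x => ?_
    · simp only [← hvx]
      exact (cv.continuous.mul ((cup _).continuous.mul
        (hη.mul hη).continuous)).integrable_of_hasCompactSupport kη2.mul_left.mul_left
    · have := mul_le_mul_of_nonneg_right (young_sol (p := p) hs (u0 x) (v0 x) hl)
        (mul_self_nonneg (η x))
      rw [show 2 * ((p + 1) * s / 4) - 1 = (p + 1) * s / 2 - 1 by ring, ← hvx]
      refine (le_of_eq ?_).trans (this.trans (le_of_eq ?_)) <;> ring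
  have hB : ∫ x, - lap v x * (v x ^ (2 * (s / 2) - 1) * (η x * η x))
      ≤ l ^ (s - 1) * (1 / s * I + (1 - 1 / s) * J) := by
    rw [hI, hJ, ← integral_const_mul, ← integral_const_mul, ← integral_add (iI.const_mul _)
      (iJ.const_mul _), ← integral_const_mul]
    refine integral_mono ?_ (((iI.const_mul _).add (iJ.const_mul _)).const_mul _) fun x => ?_
    · simp only [lapv]
      exact ((cup _).continuous.mul ((cvp _).continuous.mul
        (hη.mul hη).continuous)).integrable_of_hasCompactSupport kη2.mul_left.mul_left
    · have := mul_le_mul_of_nonneg_right (young_sol' (p := p) hs (u0 x) (v0 x) hl)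
        (mul_self_nonneg (η x))
      rw [show 2 * (s / 2) - 1 = s - 1 by ring, lapv]
      refine (le_of_eq ?_).trans (this.trans (le_of_eq ?_)) <;> ring
  have key := le_of_coupled ha hb hl hlab (eI ▸ S₁.trans G₁) (eJ ▸ S₂.trans G₂) hA hB
  have I0 : 0 ≤ I := by
    rw [hI]
    exact integral_nonneg fun x => mul_nonneg (rpow_nonneg (u0 x).le _) (mul_self_nonneg _)
  have J0 : 0 ≤ J := by
    rw [hJ]
    refine integral_nonneg fun x => mul_nonneg (mul_nonneg (rpow_nonneg hl.le _)
      (mul_nonneg (rpow_nonneg (u0 x).le _) (rpow_nonneg (v0 x).le _))) (mul_self_nonneg _)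
  have hE : ∫ x, u x ^ (2 * ((p + 1) * s / 4)) * w x ≤ K * ∫ x, v x ^ s * w x := by
    rw [← integral_const_mul]
    refine integral_mono ?_ ?_ fun x => ?_
    · exact ((cup _).continuous.mul cw).integrable_of_hasCompactSupport kw.mul_left
    · exact (continuous_const.mul
        ((cvp _).continuous.mul cw)).integrable_of_hasCompactSupport kw.mul_left.mul_left
    · have h3 : u x ^ ((p + 1) / 2) ≤ (√(2 / (p + 1)))⁻¹ * v x := by
        rw [le_inv_mul_iff₀ hq]; exact huv x
      have h4 := rpow_le_rpow (rpow_nonneg (u0 x).le _) h3 (by linarith : 0 ≤ s)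
      rw [mul_rpow (by positivity) (v0 x).le, ← hK, ← rpow_mul (u0 x).le] at h4
      rw [show 2 * ((p + 1) * s / 4) = (p + 1) / 2 * s by ring, ← mul_assoc]
      exact mul_le_mul_of_nonneg_right h4 (w0 x)
  rw [show 2 * (s / 2) = s by ring] at key G₂
  rw [show 2 * (s / 2) = s by ring] at hB
  obtain ⟨X, hX⟩ : ∃ X, X = ∫ x, v x ^ s * w x := ⟨_, rfl⟩
  rw [← hX] at key hE G₂
  have hIJ : I + J ≤ (C₁ * K + l ^ (-s) * C₂) / (√p - √(a * b)) * X := by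
    rw [div_mul_eq_mul_div, le_div_iff₀ hgap]
    have := mul_le_mul_of_nonneg_left hE hC₁
    linarith
  have hB2 : 1 / s * I + (1 - 1 / s) * J ≤ I + J := by
    have : 1 / s ≤ 1 := by rw [div_le_one (by linarith)]; exact hs.le
    have : 0 ≤ 1 / s := by positivity
    nlinarith
  have hB3 := mul_le_mul_of_nonneg_left (hB.trans (mul_le_mul_of_nonneg_left (hB2.trans hIJ)
    (by positivity : 0 ≤ l ^ (s - 1)))) hb.le
  simp only [← hvx]
  rw [← hX]
  linarith

end Dirichlet

section Interpolation

variable {n : ℕ}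

lemma integral_rpow_mul_rpow_le {f g : Eucl n → ℝ} (cf : Continuous f) (cg : Continuous g)
    (kf : HasCompactSupport f) (kg : HasCompactSupport g) (f0 : ∀ x, 0 ≤ f x)
    (g0 : ∀ x, 0 ≤ g x) {t : ℝ} (ht0 : 0 < t) (ht1 : t < 1) :
    ∫ x, f x ^ (1 - t) * g x ^ t ≤ (∫ x, f x) ^ (1 - t) * (∫ x, g x) ^ t := by
  have ht2 : 0 < 1 - t := by linarith
  have hpq : (1 / (1 - t)).HolderConjugate (1 / t) := by
    rw [Real.holderConjugate_iff]
    refine ⟨by rw [lt_div_iff₀ ht2]; linarith, by simp⟩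
  have cft : Continuous fun x => f x ^ (1 - t) := cf.rpow_const fun _ => Or.inr ht2.le
  have cgt : Continuous fun x => g x ^ t := cg.rpow_const fun _ => Or.inr ht0.le
  have := integral_mul_le_Lp_mul_Lq_of_nonneg (μ := (volume : Measure (Eucl n))) hpq
    (f := fun x => f x ^ (1 - t)) (g := fun x => g x ^ t)
    (Filter.Eventually.of_forall fun x => rpow_nonneg (f0 x) _)
    (Filter.Eventually.of_forall fun x => rpow_nonneg (g0 x) _)
    (cft.memLp_of_hasCompactSupport (kf.rpow_const ht2.ne'))
    (cgt.memLp_of_hasCompactSupport (kg.rpow_const ht0.ne'))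
  simp only [← rpow_mul (f0 _), ← rpow_mul (g0 _), one_div, inv_inv,
    mul_inv_cancel₀ ht2.ne', mul_inv_cancel₀ ht0.ne', rpow_one] at this
  exact this

lemma exists_sobolev (hn : 2 < n) : ∃ C : ℝ, 0 ≤ C ∧ ∀ φ : Eucl n → ℝ, ContDiff ℝ 1 φ →
    HasCompactSupport φ → ∫ x, |φ x| ^ (2 * (n / (n - 2) : ℝ)) ≤
      C * (∫ x, gdot φ φ x) ^ (n / (n - 2) : ℝ) := by
  have hn' : (2 : ℝ) < n := by exact_mod_cast hn
  set κ : ℝ := n / (n - 2) with hκ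
  have hκ0 : 0 < κ := div_pos (by linarith) (by linarith)
  set K := eLpNormLESNormFDerivOfEqInnerConst (volume : Measure (Eucl n)) (2 : ℝ) with hK
  refine ⟨(K : ℝ) ^ (2 * κ), by positivity, fun φ cφ kφ => ?_⟩
  have H := eLpNorm_le_eLpNorm_fderiv_of_eq_inner (volume : Measure (Eucl n)) cφ kφ
    (p := 2) (p' := (2 * κ).toNNReal) (by norm_num) (by simp; omega) (by
      rw [Real.coe_toNNReal _ (by positivity), hκ]
      simp only [finrank_euclideanSpace, Fintype.card_fin, NNReal.coe_inv, NNReal.coe_ofNat]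
      have : (n : ℝ) - 2 ≠ 0 := by linarith
      field_simp)
  have m1 : MemLp φ ((2 * κ).toNNReal : ENNReal) volume :=
    cφ.continuous.memLp_of_hasCompactSupport kφ
  have m2 : MemLp (fderiv ℝ φ) ((2 : NNReal) : ENNReal) volume :=
    (cφ.continuous_fderiv one_ne_zero).memLp_of_hasCompactSupport (kφ.fderiv ℝ)
  have hpos : (0 : NNReal) < (2 * κ).toNNReal := by rw [Real.toNNReal_pos]; positivity
  rw [m1.eLpNorm_eq_integral_rpow_norm (by exact_mod_cast hpos.ne') ENNReal.coe_ne_top,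
    m2.eLpNorm_eq_integral_rpow_norm (by norm_num) ENNReal.coe_ne_top] at H
  simp only [ENNReal.coe_toReal, Real.coe_toNNReal _ (by positivity : 0 ≤ 2 * κ), norm_eq_abs,
    NNReal.coe_ofNat, rpow_two, norm_fderiv_sq] at H
  have A0 : 0 ≤ ∫ x, |φ x| ^ (2 * κ) := integral_nonneg fun x => by positivity
  have B0 : 0 ≤ ∫ x, gdot φ φ x := integral_nonneg fun x => gdot_self_nonneg x
  have B1 := rpow_nonneg B0 (2 : ℝ)⁻¹
  rw [← ENNReal.ofReal_coe_nnreal, ← ENNReal.ofReal_mul (by positivity),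
    ENNReal.ofReal_le_ofReal_iff (mul_nonneg K.coe_nonneg B1)] at H
  have H2 := rpow_le_rpow (by positivity) H (by positivity : 0 ≤ 2 * κ)
  rw [← rpow_mul A0, inv_mul_cancel₀ (by positivity), rpow_one, mul_rpow K.coe_nonneg B1,
    ← rpow_mul B0] at H2
  rw [show (2 : ℝ)⁻¹ * (2 * κ) = κ by ring] at H2
  exact H2

lemma exists_bound_integral_lap_mul (n : ℕ) {p : ℝ} (hp : 1 < p) {ψ : Eucl n → ℝ}
    (cψ : ContDiff ℝ 2 ψ) (kψ : HasCompactSupport ψ) :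
    ∃ C : ℝ, ∀ u : Eucl n → ℝ, IsSol p u → ∫ x, - lap u x * ψ x ≤ C := by
  obtain ⟨ρ, hρ⟩ := kψ.isCompact.isBounded.subset_closedBall (0 : Eucl n)
  obtain ⟨C, hC⟩ := exists_bound_integral_rpow_of_le n hp (q := 1) zero_le_one hp.le
    (ρ := max ρ 1) (by positivity)
  obtain ⟨M, hM⟩ := (continuous_lap cψ).neg.bounded_above_of_compact_support kψ.lap.neg
  have hM0 : 0 ≤ M := (norm_nonneg _).trans (hM 0)
  refine ⟨M * C, fun u hu => ?_⟩
  have cu : ContDiff ℝ 2 u := hu.contDiff.of_le (by norm_num)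
  have e : ∫ x, - lap u x * ψ x = ∫ x, u x * - lap ψ x := by
    simp only [neg_mul, mul_neg, integral_neg, integral_lap_mul_eq cu cψ kψ]
  rw [e]
  refine (integral_mul_le_of_bound hu.contDiff.continuous (continuous_lap cψ).neg
    (fun x => (hu.pos x).le) (fun x => (le_abs_self _).trans (hM x)) (ρ := max ρ 1)
    fun x hx => ?_).trans (mul_le_mul_of_nonneg_left ?_ hM0)
  · change - lap ψ x = 0
    rw [lap_eq_zero_of_notMem_tsupport, neg_zero]
    exact fun h => hx (Metric.closedBall_subset_closedBall (le_max_left _ _) (hρ h))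
  · simpa using hC u hu

lemma le_rpow_of_le_mul_rpow {Y D θ : ℝ} (hY : 0 ≤ Y) (hθ : θ < 1)
    (h : Y ≤ D * Y ^ θ) : Y ≤ max D 0 ^ (1 / (1 - θ)) := by
  rcases hY.eq_or_lt with rfl | hY
  · positivity
  have h1 : Y ^ (1 - θ) ≤ D := by
    rw [rpow_sub hY, rpow_one, div_le_iff₀ (by positivity)]
    exact h
  have h2 := rpow_le_rpow (by positivity) (h1.trans (le_max_left D 0))
    (by rw [one_div, inv_nonneg]; linarith : 0 ≤ 1 / (1 - θ))
  rwa [← rpow_mul hY.le, mul_one_div_cancel (by linarith), rpow_one] at h2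

lemma exists_bound_gdot_pow {ζ : Eucl n → ℝ} (hζ : ContDiff ℝ ∞ ζ) (hc : HasCompactSupport ζ)
    (h0 : ∀ x, 0 ≤ ζ x) (j : ℕ) (hj : j ≠ 0) : ∃ C : ℝ, 0 ≤ C ∧
      (∀ x, gdot (fun y => ζ y ^ (j + 2)) (fun y => ζ y ^ (j + 2)) x ≤ C * ζ x ^ (2 * j + 2)) ∧
      ∀ x, |lap (fun y => ζ y ^ (j + 2) * ζ y ^ (j + 2)) x| ≤ C * ζ x ^ (2 * j + 2) := by
  obtain ⟨C₁, hC₁, H₁⟩ := exists_bound_lap_pow hζ hc h0 (2 * j + 2) (by omega)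
  obtain ⟨C₂, hC₂, H₂⟩ := exists_bound_lap_pow hζ hc h0 j hj
  have e : (fun y => ζ y ^ (j + 2) * ζ y ^ (j + 2)) = fun y => ζ y ^ (2 * j + 2 + 2) := by
    ext y; ring
  have cη : ContDiff ℝ 2 fun y => ζ y ^ (j + 2) := (contDiff_two_of_infty hζ).pow _
  refine ⟨C₁ + C₂, by positivity, fun x => ?_, fun x => ?_⟩
  · have h1 := lap_mul cη cη x
    rw [e] at h1
    have h2 := H₁ x
    have h3 : |ζ x ^ (j + 2) * lap (fun y => ζ y ^ (j + 2)) x| ≤ C₂ * ζ x ^ (2 * j + 2) := by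
      rw [abs_mul, abs_of_nonneg (pow_nonneg (h0 x) _)]
      refine (mul_le_mul_of_nonneg_left (H₂ x) (pow_nonneg (h0 x) _)).trans (le_of_eq ?_)
      ring
    have h4 := abs_le.1 h2
    have h5 := abs_le.1 h3
    have h6 : 0 ≤ C₁ * ζ x ^ (2 * j + 2) := mul_nonneg hC₁ (pow_nonneg (h0 x) _)
    linarith
  · rw [e]
    have := mul_nonneg hC₂ (pow_nonneg (h0 x) (2 * j + 2))
    linarith [H₁ x]

end Interpolation

section MainBound

variable {n : ℕ}

lemma IsSol.neg_lap_pos (hn : 0 < n) {p : ℝ} (hp : 1 < p) {u : Eucl n → ℝ} (hu : IsSol p u)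
    (x : Eucl n) : 0 < - lap u x :=
  (mul_pos (Real.sqrt_pos.2 (div_pos two_pos (by linarith)))
    (rpow_pos_of_pos (hu.pos x) _)).trans_le (hu.rpow_le_neg_lap hn hp x)

lemma rpow_mul_pow_le {v z κ s t : ℝ} {j : ℕ} (hv : 0 < v) (hz : 0 < z) (hz1 : z ≤ 1)
    (ht : 1 - t + κ * s * t = s) (hj : 1 ≤ (j + 2) * (1 - κ * t)) :
    v ^ s * z ^ (2 * j + 2) ≤ v ^ (1 - t) * (|v ^ (s / 2) * z ^ (j + 2)| ^ (2 * κ)) ^ t := by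
  have hvz : 0 < v ^ (s / 2) * z ^ (j + 2) := by positivity
  have e : v ^ (1 - t) * (|v ^ (s / 2) * z ^ (j + 2)| ^ (2 * κ)) ^ t =
      v ^ s * z ^ (((j + 2 : ℕ) : ℝ) * (2 * κ * t)) := by
    rw [abs_of_pos hvz, ← rpow_mul hvz.le, mul_rpow (by positivity) (by positivity),
      ← rpow_mul hv.le, ← rpow_natCast, ← rpow_mul hz.le, ← mul_assoc, ← rpow_add hv]
    congr 2
    linarith
  rw [e, ← rpow_natCast z]
  refine mul_le_mul_of_nonneg_left (rpow_le_rpow_of_exponent_ge hz hz1 ?_) (by positivity)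
  push_cast
  linarith

lemma exists_bound_integral_neg_lap_rpow (hn : 2 < n) {p s : ℝ} (hp : 1 < p) (hs : 1 < s)
    (hps : ((p + 1) * s / 4) ^ 2 / (2 * ((p + 1) * s / 4) - 1) *
      ((s / 2) ^ 2 / (2 * (s / 2) - 1)) < p) :
    ∃ C : ℝ, ∀ u : Eucl n → ℝ, IsSol p u → IsWeaklyStable p u →
      ∫ x in Metric.closedBall 0 1, (- lap u x) ^ ((n / (n - 2) : ℝ) * s) ≤ C := by
  have hn' : (2 : ℝ) < n := by exact_mod_cast hn
  obtain ⟨CS, hCS, HS⟩ := exists_sobolev hn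
  obtain ⟨κ, hκ⟩ : ∃ κ : ℝ, κ = n / (n - 2) := ⟨_, rfl⟩
  rw [← hκ] at HS ⊢
  have hκ1 : 1 < κ := by rw [hκ, lt_div_iff₀ (by linarith)]; linarith
  have hκs : 0 < κ * s - 1 := by nlinarith
  obtain ⟨t, htdef⟩ : ∃ t : ℝ, t = (s - 1) / (κ * s - 1) := ⟨_, rfl⟩
  have ht0 : 0 < t := by rw [htdef]; exact div_pos (by linarith) hκs
  have hκt : κ * t < 1 := by
    rw [htdef, ← mul_div_assoc, div_lt_one hκs]; linarith
  have ht1 : t < 1 := by nlinarith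
  have hts : 1 - t + κ * s * t = s := by
    have : t * (κ * s - 1) = s - 1 := by rw [htdef, div_mul_cancel₀ _ hκs.ne']
    linarith
  obtain ⟨k, hk⟩ := exists_nat_ge (1 / (1 - κ * t))
  rw [div_le_iff₀ (by linarith)] at hk
  obtain ⟨j, hj0, hj⟩ : ∃ j : ℕ, j ≠ 0 ∧ 1 ≤ ((j : ℝ) + 2) * (1 - κ * t) := by
    refine ⟨k + 1, by omega, hk.trans (mul_le_mul_of_nonneg_right ?_ (by linarith))⟩
    push_cast
    linarith
  obtain ⟨ζ, cζ, kζ, ζ0, ζ1, ζe, ζs⟩ := exists_cutoff n one_pos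
  obtain ⟨ψ, cψ, kψ, ψ0, -, ψe, -⟩ := exists_cutoff n two_pos
  obtain ⟨C₀, hC₀, h1, h2⟩ := exists_bound_gdot_pow cζ kζ ζ0 j hj0
  have cη : ContDiff ℝ 2 fun y => ζ y ^ (j + 2) := (contDiff_two_of_infty cζ).pow _
  have kpow : ∀ i : ℕ, i ≠ 0 → HasCompactSupport fun y => ζ y ^ i := fun i hi =>
    kζ.comp_left (g := fun y : ℝ => y ^ i) (zero_pow hi)
  obtain ⟨C₁, hC₁, H₁⟩ := exists_bound_dirichlet (by omega) hp hs hps cη (kpow _ (by omega))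
    (w := fun y => ζ y ^ (2 * j + 2)) (cζ.continuous.pow _) (kpow _ (by omega)) hC₀
    (fun x => pow_nonneg (ζ0 x) _) h1 h2
  obtain ⟨C₂, H₂⟩ := exists_bound_integral_lap_mul n hp (contDiff_two_of_infty cψ) kψ
  refine ⟨max (CS * C₁ ^ κ * (C₂ ^ (1 - t)) ^ κ) 0 ^ (1 / (1 - κ * t)), fun u hu hst => ?_⟩
  have v0 := hu.neg_lap_pos (by omega) hp
  have cv : ContDiff ℝ 2 fun x => - lap u x :=
    (contDiff_lap (by norm_num; exact hu.contDiff)).neg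
  obtain ⟨g, hg⟩ : ∃ g : Eucl n → ℝ,
    g = fun x => |(- lap u x) ^ (s / 2) * ζ x ^ (j + 2)| ^ (2 * κ) := ⟨_, rfl⟩
  have cφ : ContDiff ℝ 2 fun x => (- lap u x) ^ (s / 2) * ζ x ^ (j + 2) :=
    (cv.rpow_const_of_ne fun x => (v0 x).ne').mul cη
  have kφ : HasCompactSupport fun x => (- lap u x) ^ (s / 2) * ζ x ^ (j + 2) :=
    (kpow _ (by omega)).mul_left
  have cg : Continuous g := hg ▸ cφ.continuous.abs.rpow_const fun x => Or.inr (by linarith)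
  have kg : HasCompactSupport g := hg ▸ kφ.abs.rpow_const (by linarith)
  have g0 : ∀ x, 0 ≤ g x := fun x => by rw [hg]; positivity
  have Y0 : 0 ≤ ∫ x, g x := integral_nonneg g0
  have hA0 : 0 ≤ ∫ x, - lap u x * ψ x := integral_nonneg fun x => mul_nonneg (v0 x).le (ψ0 x)
  have cw : Continuous fun x => (- lap u x) ^ s * ζ x ^ (2 * j + 2) :=
    (cv.continuous.rpow_const fun x => Or.inl (v0 x).ne').mul (cζ.continuous.pow _)
  have X0 : 0 ≤ ∫ x, (- lap u x) ^ s * ζ x ^ (2 * j + 2) := integral_nonneg fun x =>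
    mul_nonneg (rpow_nonneg (v0 x).le _) (pow_nonneg (ζ0 x) _)
  have hX : ∫ x, (- lap u x) ^ s * ζ x ^ (2 * j + 2) ≤ C₂ ^ (1 - t) * (∫ x, g x) ^ t := by
    have cf : Continuous fun x => - lap u x * ψ x := cv.continuous.mul cψ.continuous
    have kf : HasCompactSupport fun x => - lap u x * ψ x := kψ.mul_left
    have f0 : ∀ x, 0 ≤ - lap u x * ψ x := fun x => mul_nonneg (v0 x).le (ψ0 x)
    have cfg : Continuous fun x => (- lap u x * ψ x) ^ (1 - t) * g x ^ t :=
      (cf.rpow_const fun x => Or.inr (by linarith)).mul (cg.rpow_const fun x => Or.inr ht0.le)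
    calc ∫ x, (- lap u x) ^ s * ζ x ^ (2 * j + 2)
        ≤ ∫ x, (- lap u x * ψ x) ^ (1 - t) * g x ^ t := by
          refine integral_mono (cw.integrable_of_hasCompactSupport (kpow _ (by omega)).mul_left)
            (cfg.integrable_of_hasCompactSupport (kg.rpow_const ht0.ne').mul_left) fun x => ?_
          rcases (ζ0 x).eq_or_lt with h | h
          · simp only [← h, zero_pow (show 2 * j + 2 ≠ 0 by omega), mul_zero]
            exact mul_nonneg (rpow_nonneg (f0 x) _) (rpow_nonneg (g0 x) _)
          · have hx : x ∈ Metric.closedBall (0 : Eucl n) 2 := by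
              have := ζs (subset_tsupport _ (Function.mem_support.2 h.ne'))
              rwa [mul_one] at this
            simp only [ψe x hx, mul_one, hg]
            exact rpow_mul_pow_le (v0 x) h (ζ1 x) hts hj
      _ ≤ (∫ x, - lap u x * ψ x) ^ (1 - t) * (∫ x, g x) ^ t :=
          integral_rpow_mul_rpow_le cf cg kf kg f0 g0 ht0 ht1
      _ ≤ C₂ ^ (1 - t) * (∫ x, g x) ^ t :=
          mul_le_mul_of_nonneg_right (rpow_le_rpow hA0 (H₂ u hu) (by linarith))
            (rpow_nonneg Y0 _)
  have C20 : 0 ≤ C₂ ^ (1 - t) := rpow_nonneg (hA0.trans (H₂ u hu)) _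
  have hY : ∫ x, g x ≤ CS * C₁ ^ κ * (C₂ ^ (1 - t)) ^ κ * (∫ x, g x) ^ (κ * t) := by
    have hS := HS _ (cφ.of_le one_le_two) kφ
    calc ∫ x, g x ≤ CS * (C₁ * ∫ x, (- lap u x) ^ s * ζ x ^ (2 * j + 2)) ^ κ := by
          rw [hg]
          exact hS.trans (mul_le_mul_of_nonneg_left (rpow_le_rpow
            (integral_nonneg fun x => gdot_self_nonneg x) (H₁ u hu hst) (by linarith)) hCS)
      _ ≤ CS * (C₁ * (C₂ ^ (1 - t) * (∫ x, g x) ^ t)) ^ κ :=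
          mul_le_mul_of_nonneg_left (rpow_le_rpow (mul_nonneg hC₁ X0)
            (mul_le_mul_of_nonneg_left hX hC₁) (by linarith)) hCS
      _ = _ := by
          rw [mul_rpow hC₁ (mul_nonneg C20 (rpow_nonneg Y0 _)),
            mul_rpow C20 (rpow_nonneg Y0 _), ← rpow_mul Y0, mul_comm t κ]
          ring
  refine le_trans ?_ (le_rpow_of_le_mul_rpow Y0 hκt hY)
  calc ∫ x in Metric.closedBall 0 1, (- lap u x) ^ (κ * s)
      = ∫ x in Metric.closedBall 0 1, g x := by
        refine setIntegral_congr_fun Metric.isClosed_closedBall.measurableSet fun x hx => ?_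
        simp only [hg, ζe x hx, one_pow, mul_one]
        rw [abs_of_nonneg (rpow_nonneg (v0 x).le _), ← rpow_mul (v0 x).le]
        congr 1
        ring
    _ ≤ ∫ x, g x := setIntegral_le_integral (cg.integrable_of_hasCompactSupport kg)
        (Filter.Eventually.of_forall g0)

lemma not_isWeaklyStable (hn : 2 < n) {p s : ℝ} (hp : 1 < p) (hs : 1 < s)
    (hps : ((p + 1) * s / 4) ^ 2 / (2 * ((p + 1) * s / 4) - 1) *
      ((s / 2) ^ 2 / (2 * (s / 2) - 1)) < p)
    (hσ : ((n : ℝ) - 2) * (p - 1) < 2 * (p + 1) * s) {u : Eucl n → ℝ} (hu : IsSol p u) :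
    ¬ IsWeaklyStable p u := by
  intro hst
  have hn' : (2 : ℝ) < n := by exact_mod_cast hn
  obtain ⟨C, hC⟩ := exists_bound_integral_neg_lap_rpow hn hp hs hps
  obtain ⟨q, hq⟩ : ∃ q : ℝ, q = n / (n - 2) * s := ⟨_, rfl⟩
  rw [← hq] at hC
  have v0 := hu.neg_lap_pos (by omega) hp
  have cu : ContDiff ℝ 2 u := hu.contDiff.of_le (by norm_num)
  have cvq : Continuous fun x => (- lap u x) ^ q :=
    (continuous_lap cu).neg.rpow_const fun x => Or.inl (v0 x).ne'
  have vq0 : ∀ x, 0 < (- lap u x) ^ q := fun x => rpow_pos_of_pos (v0 x) _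
  obtain ⟨a, ha⟩ : ∃ a, a = ∫ x in Metric.closedBall (0 : Eucl n) 1, (- lap u x) ^ q := ⟨_, rfl⟩
  have ia : ∀ R, IntegrableOn (fun x => (- lap u x) ^ q) (Metric.closedBall (0 : Eucl n) R) :=
    fun R => cvq.continuousOn.integrableOn_compact (isCompact_closedBall _ _)
  have ha0 : 0 < a := by
    rw [ha, setIntegral_pos_iff_support_of_nonneg_ae
      (Filter.Eventually.of_forall fun x => (vq0 x).le) (ia 1)]
    have : Function.support (fun x => (- lap u x) ^ q) = Set.univ :=
      Set.eq_univ_of_forall fun x => (vq0 x).ne'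
    rw [this, Set.univ_inter]
    exact Metric.measure_closedBall_pos _ _ one_pos
  obtain ⟨γ, hγ⟩ : ∃ γ : ℝ, γ = (4 / (p - 1) + 2) * q - n := ⟨_, rfl⟩
  have hγ0 : 0 < γ := by
    have e : γ = n / ((n - 2) * (p - 1)) * (2 * (p + 1) * s - (n - 2) * (p - 1)) := by
      have : (n : ℝ) - 2 ≠ 0 := by linarith
      have : p - 1 ≠ 0 := by linarith
      rw [hγ, hq]
      field_simp
      ring
    rw [e]
    exact mul_pos (div_pos (by linarith) (mul_pos (by linarith) (by linarith))) (by linarith)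
  refine absurd (nonpos_of_forall_rpow_mul_le (a := a) (C := max C a) hγ0 fun R hR => ?_)
    (not_le.2 ha0)
  rcases le_total R 1 with hR1 | hR1
  · exact (mul_le_of_le_one_left ha0.le (rpow_le_one hR.le hR1 hγ0.le)).trans (le_max_right _ _)
  refine le_trans ?_ (le_max_left _ _)
  have H := hC _ (hu.rescale hp hR 0) (hst.rescale hp hu.pos hR)
  rw [lap_rescale cu] at H
  have e1 : ∀ x : Eucl n, (-(R ^ (4 / (p - 1)) * (R ^ 2 * lap u (0 + R • x)))) ^ q =
      R ^ ((4 / (p - 1) + 2) * q) * (fun y => (- lap u y) ^ q) (R • x) := by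
    intro x
    rw [zero_add, ← mul_assoc, ← mul_neg, mul_rpow (by positivity) (v0 _).le, rpow_mul hR.le,
      rpow_add hR, rpow_two]
  simp only [e1] at H
  rw [integral_const_mul,
    Measure.setIntegral_comp_smul_of_pos volume (fun y => (- lap u y) ^ q) _ hR,
    smul_closedBall _ _ zero_le_one, smul_zero, norm_of_nonneg hR.le, mul_one,
    finrank_euclideanSpace, Fintype.card_fin, smul_eq_mul, ← mul_assoc, ← rpow_natCast,
    ← rpow_neg hR.le, ← rpow_add hR, ← sub_eq_add_neg, ← hγ] at H
  refine le_trans (mul_le_mul_of_nonneg_left ?_ (rpow_nonneg hR.le _)) H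
  rw [ha]
  exact setIntegral_mono_set (ia R) (Filter.Eventually.of_forall fun x => (vq0 x).le)
    (Metric.closedBall_subset_closedBall hR1).eventuallyLE

end MainBound

lemma coupling_lt_of_poly_neg {p s : ℝ} (hp : 1 < p) (hs : 1 < s)
    (h : s ^ 4 * (p + 1) ^ 2 - 32 * p * (p + 1) * s ^ 2 + 32 * p * (p + 3) * s - 64 * p < 0) :
    ((p + 1) * s / 4) ^ 2 / (2 * ((p + 1) * s / 4) - 1) *
      ((s / 2) ^ 2 / (2 * (s / 2) - 1)) < p := by
  have h1 : 0 < 2 * ((p + 1) * s / 4) - 1 := by nlinarith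
  have h2 : 0 < 2 * (s / 2) - 1 := by linarith
  rw [div_mul_div_comm, div_lt_iff₀ (mul_pos h1 h2)]
  nlinarith

lemma exists_exponent (n : ℕ) (hn1 : 9 ≤ n) (hn2 : n ≤ 19) {p : ℝ} (hp : 1 < p)
    (hpn : p < (n : ℝ) / ((n : ℝ) - 8) + 1 / 100) : ∃ s : ℝ, 1 < s ∧
      s ^ 4 * (p + 1) ^ 2 - 32 * p * (p + 1) * s ^ 2 + 32 * p * (p + 3) * s - 64 * p < 0 ∧
      ((n : ℝ) - 2) * (p - 1) < 2 * (p + 1) * s := by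
  rcases lt_or_ge (((n : ℝ) - 2) * (p - 1)) (2 * (p + 1) * 2) with h | h
  · exact ⟨2, by norm_num, by nlinarith, h⟩
  interval_cases n
  · refine ⟨281 / 100, by norm_num, ?_, ?_⟩ <;> norm_num at h hpn ⊢ <;> nlinarith
  · refine ⟨267 / 100, by norm_num, ?_, ?_⟩ <;> norm_num at h hpn ⊢ <;> nlinarith
  · refine ⟨258 / 100, by norm_num, ?_, ?_⟩ <;> norm_num at h hpn ⊢ <;> nlinarith
  · refine ⟨251 / 100, by norm_num, ?_, ?_⟩ <;> norm_num at h hpn ⊢ <;> nlinarith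
  · refine ⟨246 / 100, by norm_num, ?_, ?_⟩ <;> norm_num at h hpn ⊢ <;> nlinarith
  · refine ⟨242 / 100, by norm_num, ?_, ?_⟩ <;> norm_num at h hpn ⊢ <;> nlinarith
  · refine ⟨238 / 100, by norm_num, ?_, ?_⟩ <;> norm_num at h hpn ⊢ <;> nlinarith
  · refine ⟨235 / 100, by norm_num, ?_, ?_⟩ <;> norm_num at h hpn ⊢ <;> nlinarith
  · refine ⟨233 / 100, by norm_num, ?_, ?_⟩ <;> norm_num at h hpn ⊢ <;> nlinarith
  · refine ⟨231 / 100, by norm_num, ?_, ?_⟩ <;> norm_num at h hpn ⊢ <;> nlinarith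
  · refine ⟨229 / 100, by norm_num, ?_, ?_⟩ <;> norm_num at h hpn ⊢ <;> nlinarith

theorem stmt_1 (n : ℕ) (hn1 : 9 ≤ n) (hn2 : n ≤ 19) :
    ∃ ε : ℝ, 0 < ε ∧ ∀ p : ℝ, 1 < p → p < (n : ℝ)/((n : ℝ) - 8) + ε →
      ¬ ∃ u : EuclideanSpace ℝ (Fin n) → ℝ,
        ContDiff ℝ 4 u ∧ (∀ x, 0 < u x) ∧ (∀ x, lap (lap u) x = u x ^ p) ∧
        (∀ φ : EuclideanSpace ℝ (Fin n) → ℝ, ContDiff ℝ (⊤ : ℕ∞) φ →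
          HasCompactSupport φ →
          p * ∫ x, u x ^ (p - 1) * φ x ^ 2 ≤ ∫ x, (lap φ x) ^ 2) := by
  refine ⟨1 / 100, by norm_num, fun p hp hpn => ?_⟩
  rintro ⟨u, cu, hu, heq, hst⟩
  obtain ⟨s, hs, hpoly, hσ⟩ := exists_exponent n hn1 hn2 hp hpn
  have hsol : IsSol p u := ⟨cu, hu, heq⟩
  exact not_isWeaklyStable (by omega) hp hs (coupling_lt_of_poly_neg hp hs hpoly) hσ hsol
    (hsol.isWeaklyStable hp hst)
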